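/- arXiv:0907.1793 — 6 statements merged into one kernel-verified Lean document; each statement's English description precedes it below -/
import Mathlib

section
/- Let P be a finite poset and let σ, σ̄ be linear extensions of P forming a realizer of P of cardinality 2. Then the σ-revlex and σ̄-revlex linear extensions L_σ and L_σ̄ of the downset lattice D_P form a diametral pair; that is, the distance between L_σ and L_σ̄ equals led(D_P). -/
open Finset
open scoped symmDiff

/-- `L` is a linear extension of the partial order on `α`. -/
def IsLinExt {α : Type*} [PartialOrder α] (L : α → α → Prop) : Prop :=
  IsLinearOrder α L ∧ ∀ x y : α, x ≤ y → L x y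

/-- The number of unordered pairs of elements appearing in different orders in `L₁` and `L₂`,
counted via the ordered pairs that are strictly below in `L₁` and strictly above in `L₂`. -/
noncomputable def revCount {α : Type*} (L₁ L₂ : α → α → Prop) : ℕ :=
  Set.ncard {p : α × α | p.1 ≠ p.2 ∧ L₁ p.1 p.2 ∧ L₂ p.2 p.1}

/-- The strict σ-revlex order on subsets of `[n]`: `S < T` iff the σ-largest element of the
symmetric difference `S ∆ T` belongs to `T`. -/
def SigmaRevLexLT {n : ℕ} (σ : Equiv.Perm (Fin n)) (S T : Finset (Fin n)) : Prop :=
  ∃ m ∈ T \ S, ∀ x ∈ S ∆ T, σ.symm x ≤ σ.symm m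

/-- The σ-revlex linear extension `L_σ` of the Boolean lattice, as a reflexive relation. -/
def SigmaRevLex {n : ℕ} (σ : Equiv.Perm (Fin n)) (S T : Finset (Fin n)) : Prop :=
  S = T ∨ SigmaRevLexLT σ S T

/-- The reverse `σ̄` of a permutation `σ` of `[n]`. -/
def revPermOf {n : ℕ} (σ : Equiv.Perm (Fin n)) : Equiv.Perm (Fin n) :=
  (Fin.revPerm : Equiv.Perm (Fin n)).trans σ

/-- An ordered pair `(x,y)` of a poset is a critical pair. -/
def IsCriticalPair {α : Type*} [PartialOrder α] (x y : α) : Prop :=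
  ¬ x ≤ y ∧ ¬ y ≤ x ∧ (∀ z, z < x → z < y) ∧ (∀ z, y < z → x < z)

/-- The downsets of a finite poset, as a poset ordered by inclusion. -/
abbrev DownFinset (α : Type*) [PartialOrder α] : Type _ :=
  {S : Finset α // IsLowerSet (↑S : Set α)}

/-- The strict σ-revlex order on downsets of a poset, for a linear extension `σ`. -/
def DRevLexLT {α : Type*} [PartialOrder α] [DecidableEq α] (σ : α → α → Prop)
    (S T : DownFinset α) : Prop :=
  ∃ m ∈ T.1 \ S.1, ∀ x ∈ S.1 ∆ T.1, σ x m

/-- The σ-revlex linear extension `L_σ` of the downset lattice, as a reflexive relation. -/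
def DRevLex {α : Type*} [PartialOrder α] [DecidableEq α] (σ : α → α → Prop)
    (S T : DownFinset α) : Prop :=
  S = T ∨ DRevLexLT σ S T

/-- The comparability graph of the subposet induced on `D`. -/
def compGraph {α : Type*} [PartialOrder α] (D : Set α) : SimpleGraph D :=
  SimpleGraph.fromRel fun x y => (x : α) ≤ (y : α)

/-- The number of connected components of the subposet induced on `D`. -/
noncomputable def numComponents {α : Type*} [PartialOrder α] (D : Set α) : ℕ :=
  Nat.card (compGraph D).ConnectedComponent

/-- `{σ, τ}` is a realizer of cardinality 2 of the partial order on `α`. -/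
def IsRealizer2 {α : Type*} [PartialOrder α] (σ τ : α → α → Prop) : Prop :=
  IsLinExt σ ∧ IsLinExt τ ∧ ∀ x y : α, x ≤ y ↔ σ x y ∧ τ x y

/-- A linear extension `π` is non-separating. -/
def NonSeparating {α : Type*} [PartialOrder α] (π : α → α → Prop) : Prop :=
  ¬ ∃ u v x : α, u < v ∧ ¬ x ≤ u ∧ ¬ u ≤ x ∧ ¬ x ≤ v ∧ ¬ v ≤ x ∧
      π u x ∧ u ≠ x ∧ π x v ∧ x ≠ v

/-- The principal downset of an element. -/
def pdown {α : Type*} [Fintype α] [PartialOrder α] [DecidableEq α]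
    [DecidableRel ((· ≤ ·) : α → α → Prop)] (x : α) : DownFinset α :=
  ⟨Finset.univ.filter (· ≤ x), by
    intro a b hba ha
    simp only [Finset.mem_coe, Finset.mem_filter] at ha ⊢
    exact ⟨Finset.mem_univ b, hba.trans ha.2⟩⟩

open scoped FinsetFamily

section DistribLattice

variable {D : Type*} [DistribLattice D] [Fintype D]

open Classical in
/-- The pairs of elements with infimum `a` and supremum `b`. -/
noncomputable def complPairs (a b : D) : Finset (D × D) :=
  {p | p.1 ⊓ p.2 = a ∧ p.1 ⊔ p.2 = b}

theorem mem_complPairs {a b : D} {p : D × D} :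
    p ∈ complPairs a b ↔ p.1 ⊓ p.2 = a ∧ p.1 ⊔ p.2 = b := by
  simp [complPairs]

theorem swap_mem_complPairs {a b : D} {p : D × D} (hp : p ∈ complPairs a b) :
    p.swap ∈ complPairs a b := by
  simpa [mem_complPairs, inf_comm, sup_comm] using hp

theorem inf_sup_mem_complPairs {a b : D} {p q : D × D} (hp : p ∈ complPairs a b)
    (hq : q ∈ complPairs a b) : (p.1 ⊓ q.1, p.2 ⊔ q.2) ∈ complPairs a b := by
  obtain ⟨hp₁, hp₂⟩ := mem_complPairs.1 hp
  obtain ⟨hq₁, hq₂⟩ := mem_complPairs.1 hq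
  refine mem_complPairs.2 ⟨?_, ?_⟩
  · have h₁ : p.1 ⊓ q.1 ⊓ p.2 = a ⊓ q.1 := by rw [← hp₁]; ac_rfl
    have h₂ : p.1 ⊓ q.1 ⊓ q.2 = a ⊓ p.1 := by rw [← hq₁]; ac_rfl
    have h₃ : a ≤ q.1 := hq₁ ▸ inf_le_left
    have h₄ : a ≤ p.1 := hp₁ ▸ inf_le_left
    simp only [inf_sup_left, h₁, h₂, inf_eq_left.2 h₃, inf_eq_left.2 h₄, sup_idem]
  · have h₁ : p.1 ⊔ (p.2 ⊔ q.2) = b ⊔ q.2 := by rw [← hp₂]; ac_rfl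
    have h₂ : q.1 ⊔ (p.2 ⊔ q.2) = b ⊔ p.2 := by rw [← hq₂]; ac_rfl
    have h₃ : q.2 ≤ b := hq₂ ▸ le_sup_right
    have h₄ : p.2 ≤ b := hp₂ ▸ le_sup_right
    simp only [sup_inf_right, h₁, h₂, sup_eq_left.2 h₃, sup_eq_left.2 h₄, inf_idem]

open Classical in
/-- The pairs in `complPairs a b` that are ordered one way by `L₁` and the other way by `L₂`. -/
noncomputable def revPairs (L₁ L₂ : D → D → Prop) (a b : D) : Finset (D × D) :=
  {p ∈ complPairs a b | p.1 ≠ p.2 ∧ L₁ p.1 p.2 ∧ L₂ p.2 p.1}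

theorem mem_revPairs {L₁ L₂ : D → D → Prop} {a b : D} {p : D × D} :
    p ∈ revPairs L₁ L₂ a b ↔ p ∈ complPairs a b ∧ p.1 ≠ p.2 ∧ L₁ p.1 p.2 ∧ L₂ p.2 p.1 := by
  simp [revPairs]

theorem revCount_eq_sum_card_revPairs (L₁ L₂ : D → D → Prop) :
    revCount L₁ L₂ = ∑ q : D × D, #(revPairs L₁ L₂ q.1 q.2) := by
  classical
  rw [revCount, Set.ncard_eq_toFinset_card',
    card_eq_sum_card_fiberwise (f := fun p : D × D => (p.1 ⊓ p.2, p.1 ⊔ p.2)) (t := univ)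
      (fun _ _ => by simp)]
  refine sum_congr rfl fun q _ => congrArg card ?_
  ext p
  simp only [mem_filter, Set.mem_toFinset, Set.mem_ofPred_eq, mem_revPairs, mem_complPairs,
    Prod.ext_iff]
  tauto

theorem not_le_of_mem_revPairs {L₁ L₂ : D → D → Prop} (h₁ : IsLinExt L₁) (h₂ : IsLinExt L₂)
    {a b : D} {p : D × D} (hp : p ∈ revPairs L₁ L₂ a b) : ¬ p.1 ≤ p.2 ∧ ¬ p.2 ≤ p.1 := by
  obtain ⟨-, hne, hl₁, hl₂⟩ := mem_revPairs.1 hp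
  exact ⟨fun h => hne (h₂.1.antisymm _ _ (h₂.2 _ _ h) hl₂),
    fun h => hne (h₁.1.antisymm _ _ hl₁ (h₁.2 _ _ h))⟩

open Classical in
/-- At most half of the ordered pairs of complements are increasing in a linear extension. -/
theorem two_mul_card_filter_le {L : D → D → Prop} (h : IsLinExt L) (a b : D) :
    2 * #{p ∈ complPairs a b | p.1 ≠ p.2 ∧ L p.1 p.2} ≤ #(complPairs a b) := by
  set F := {p ∈ complPairs a b | p.1 ≠ p.2 ∧ L p.1 p.2} with hF
  have hdisj : Disjoint F (F.image Prod.swap) := by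
    rw [disjoint_left]
    rintro p hp hp'
    obtain ⟨q, hq, rfl⟩ := mem_image.1 hp'
    simp only [hF, mem_filter, Prod.fst_swap, Prod.snd_swap] at hp hq
    exact hq.2.1 (h.1.antisymm _ _ hq.2.2 hp.2.2)
  have hsub : F ∪ F.image Prod.swap ⊆ complPairs a b := by
    refine union_subset (filter_subset _ _) fun p hp => ?_
    obtain ⟨q, hq, rfl⟩ := mem_image.1 hp
    exact swap_mem_complPairs (mem_filter.1 hq).1
  have := card_le_card hsub
  rw [card_union_of_disjoint hdisj, card_image_of_injective _ Prod.swap_injective] at this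
  omega

/-- Any two linear extensions reverse at most a quarter of the ordered pairs of complements in an
interval. -/
theorem four_mul_card_revPairs_le {L₁ L₂ : D → D → Prop} (h₁ : IsLinExt L₁) (h₂ : IsLinExt L₂)
    (a b : D) : 4 * #(revPairs L₁ L₂ a b) ≤ #(complPairs a b) := by
  classical
  set X := complPairs a b with hX
  set R := revPairs L₁ L₂ a b with hR
  set F := {p ∈ X | p.1 ≠ p.2 ∧ L₁ p.1 p.2} with hF
  set G := {p ∈ X | p.1 ≠ p.2 ∧ L₂ p.1 p.2} with hG
  have hF2 : 2 * #F ≤ #X := two_mul_card_filter_le h₁ a b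
  have hG2 : 2 * #G ≤ #X := two_mul_card_filter_le h₂ a b
  let e : D × D → D × Dᵒᵈ := fun p => (p.1, OrderDual.toDual p.2)
  have he : Function.Injective e := fun p q hpq => hpq
  have key := le_card_infs_mul_card_sups (R.image e) (X.image e)
  rw [card_image_of_injective _ he, card_image_of_injective _ he] at key
  have hinf : #(R.image e ⊼ X.image e) ≤ #F := by
    rw [← card_image_of_injective F he]
    refine card_le_card fun z hz => ?_
    obtain ⟨_, hp', _, hq', rfl⟩ := mem_infs.1 hz
    obtain ⟨p, hp, rfl⟩ := mem_image.1 hp'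
    obtain ⟨q, hq, rfl⟩ := mem_image.1 hq'
    obtain ⟨hpX, hne, hl₁, hl₂⟩ := mem_revPairs.1 hp
    refine mem_image.2 ⟨(p.1 ⊓ q.1, p.2 ⊔ q.2),
      mem_filter.2 ⟨inf_sup_mem_complPairs hpX hq, ?_, ?_⟩, rfl⟩
    · intro h
      exact (not_le_of_mem_revPairs h₁ h₂ hp).2
        (le_sup_left.trans (h.symm.le.trans inf_le_left))
    · exact h₁.1.trans _ _ _ (h₁.2 _ _ inf_le_left) (h₁.1.trans _ _ _ hl₁ (h₁.2 _ _ le_sup_left))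
  have hsup : #(R.image e ⊻ X.image e) ≤ #G := by
    rw [← card_image_of_injective G (he.comp Prod.swap_injective)]
    refine card_le_card fun z hz => ?_
    obtain ⟨_, hp', _, hq', rfl⟩ := mem_sups.1 hz
    obtain ⟨p, hp, rfl⟩ := mem_image.1 hp'
    obtain ⟨q, hq, rfl⟩ := mem_image.1 hq'
    obtain ⟨hpX, hne, hl₁, hl₂⟩ := mem_revPairs.1 hp
    refine mem_image.2 ⟨(p.2 ⊓ q.2, p.1 ⊔ q.1), mem_filter.2
      ⟨inf_sup_mem_complPairs (swap_mem_complPairs hpX) (swap_mem_complPairs hq), ?_, ?_⟩, rfl⟩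
    · intro h
      exact (not_le_of_mem_revPairs h₁ h₂ hp).1
        (le_sup_left.trans (h.symm.le.trans inf_le_left))
    · exact h₂.1.trans _ _ _ (h₂.2 _ _ inf_le_left) (h₂.1.trans _ _ _ hl₂ (h₂.2 _ _ le_sup_left))
  have hRX : #R ≤ #X := card_le_card (filter_subset _ _)
  rcases Nat.eq_zero_or_pos #X with h0 | hpos
  · omega
  · refine Nat.le_of_mul_le_mul_right ?_ hpos
    calc 4 * #R * #X = 4 * (#R * #X) := by ring
      _ ≤ 4 * (#F * #G) := Nat.mul_le_mul_left _ (key.trans (Nat.mul_le_mul hinf hsup))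
      _ = (2 * #F) * (2 * #G) := by ring
      _ ≤ #X * #X := Nat.mul_le_mul hF2 hG2

end DistribLattice

section Revlex

variable {α : Type*} [PartialOrder α]

theorem exists_greatest_of_isLinExt {σ : α → α → Prop} (h : IsLinExt σ) {s : Finset α}
    (hs : s.Nonempty) : ∃ m ∈ s, ∀ x ∈ s, σ x m := by
  induction hs using Finset.Nonempty.cons_induction with
  | singleton a => exact ⟨a, by simp, by simpa using h.1.refl a⟩
  | cons a s ha hs ih =>
    obtain ⟨m, hm, hmax⟩ := ih
    rcases h.1.total a m with ham | hma
    · refine ⟨m, by simp [hm], fun x hx => ?_⟩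
      rcases mem_cons.1 hx with rfl | hx
      exacts [ham, hmax x hx]
    · refine ⟨a, by simp, fun x hx => ?_⟩
      rcases mem_cons.1 hx with rfl | hx
      exacts [h.1.refl x, h.1.trans _ _ _ (hmax x hx) hma]

theorem downFinset_ext_iff {S T : DownFinset α} : S = T ↔ ∀ x, x ∈ S.1 ↔ x ∈ T.1 := by
  rw [Subtype.ext_iff, Finset.ext_iff]

variable [DecidableEq α]

theorem DRevLexLT.not_gt {σ : α → α → Prop} (h : IsLinExt σ) {S T : DownFinset α}
    (hST : DRevLexLT σ S T) : ¬ DRevLexLT σ T S := by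
  rintro ⟨m', hm', hmax'⟩
  obtain ⟨m, hm, hmax⟩ := hST
  rw [mem_sdiff] at hm hm'
  have := h.1.antisymm m m' (hmax' m (by simp [mem_symmDiff, hm]))
    (hmax m' (by simp [mem_symmDiff, hm']))
  subst this
  exact hm.2 hm'.1

theorem DRevLexLT.trans {σ : α → α → Prop} (h : IsLinExt σ) {S T U : DownFinset α}
    (hST : DRevLexLT σ S T) (hTU : DRevLexLT σ T U) : DRevLexLT σ S U := by
  obtain ⟨m, hm, hmax⟩ := hST
  obtain ⟨m', hm', hmax'⟩ := hTU
  simp only [mem_sdiff, mem_symmDiff] at hm hm' hmax hmax'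
  rcases h.1.total m m' with hmm | hmm
  · refine ⟨m', mem_sdiff.2 ⟨hm'.1, fun hS => ?_⟩, fun x hx => ?_⟩
    · have := h.1.antisymm _ _ hmm (hmax m' (Or.inl ⟨hS, hm'.2⟩))
      exact hm'.2 (this ▸ hm.1)
    · rw [mem_symmDiff] at hx
      by_cases hxT : x ∈ T.1
      · by_cases hxS : x ∈ S.1
        · exact hmax' x (by tauto)
        · exact h.1.trans _ _ _ (hmax x (by tauto)) hmm
      · by_cases hxS : x ∈ S.1
        · exact h.1.trans _ _ _ (hmax x (by tauto)) hmm
        · exact hmax' x (by tauto)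
  · refine ⟨m, mem_sdiff.2 ⟨by_contra fun hU => ?_, hm.2⟩, fun x hx => ?_⟩
    · have := h.1.antisymm _ _ hmm (hmax' m (Or.inl ⟨hm.1, hU⟩))
      exact hm'.2 (this ▸ hm.1)
    · rw [mem_symmDiff] at hx
      by_cases hxT : x ∈ T.1
      · by_cases hxS : x ∈ S.1
        · exact h.1.trans _ _ _ (hmax' x (by tauto)) hmm
        · exact hmax x (by tauto)
      · by_cases hxS : x ∈ S.1
        · exact hmax x (by tauto)
        · exact h.1.trans _ _ _ (hmax' x (by tauto)) hmm

theorem isLinExt_dRevLex {σ : α → α → Prop} (h : IsLinExt σ) : IsLinExt (DRevLex σ) := by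
  refine ⟨{ refl := fun S => Or.inl rfl, trans := ?_, antisymm := ?_, total := ?_ }, ?_⟩
  · rintro S T U (rfl | hST) (rfl | hTU)
    exacts [Or.inl rfl, Or.inr hTU, Or.inr hST, Or.inr (hST.trans h hTU)]
  · rintro S T (rfl | hST) (hTS | hTS)
    exacts [rfl, rfl, hTS.symm, (hST.not_gt h hTS).elim]
  · intro S T
    by_cases hne : S = T
    · exact Or.inl (Or.inl hne)
    obtain ⟨m, hm, hmax⟩ := exists_greatest_of_isLinExt h (s := S.1 ∆ T.1)
      (nonempty_iff_ne_empty.2 fun h0 => hne (Subtype.ext (symmDiff_eq_bot.1 h0)))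
    rcases mem_symmDiff.1 hm with hm' | hm'
    · exact Or.inr (Or.inr ⟨m, mem_sdiff.2 hm', fun x hx => hmax x (symmDiff_comm S.1 T.1 ▸ hx)⟩)
    · exact Or.inl (Or.inr ⟨m, mem_sdiff.2 hm', hmax⟩)
  · intro S T hST
    by_cases hne : S = T
    · exact Or.inl hne
    obtain ⟨m, hm, hmax⟩ := exists_greatest_of_isLinExt h (s := S.1 ∆ T.1)
      (nonempty_iff_ne_empty.2 fun h0 => hne (Subtype.ext (symmDiff_eq_bot.1 h0)))
    refine Or.inr ⟨m, ?_, hmax⟩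
    rcases mem_symmDiff.1 hm with hm' | hm'
    · exact (hm'.2 (hST hm'.1)).elim
    · exact mem_sdiff.2 hm'

/-- Downsets form a distributive lattice under union and intersection. -/
abbrev downFinsetDistribLattice : DistribLattice (DownFinset α) :=
  { (inferInstance : PartialOrder (DownFinset α)) with
    sup := fun S T => ⟨S.1 ∪ T.1, by simpa using S.2.union T.2⟩
    inf := fun S T => ⟨S.1 ∩ T.1, by simpa using S.2.inter T.2⟩
    le_sup_left := fun S T => (subset_union_left : S.1 ⊆ S.1 ∪ T.1)
    le_sup_right := fun S T => (subset_union_right : T.1 ⊆ S.1 ∪ T.1)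
    sup_le := fun S T U (hS : S.1 ⊆ U.1) (hT : T.1 ⊆ U.1) => union_subset hS hT
    inf_le_left := fun S T => (inter_subset_left : S.1 ∩ T.1 ⊆ S.1)
    inf_le_right := fun S T => (inter_subset_right : S.1 ∩ T.1 ⊆ T.1)
    le_inf := fun S T U (hT : S.1 ⊆ T.1) (hU : S.1 ⊆ U.1) => subset_inter hT hU
    le_sup_inf := fun S T U =>
      (union_inter_distrib_left S.1 T.1 U.1).symm.subset }

attribute [local instance] downFinsetDistribLattice

open Classical in
/-- A finite poset has finitely many downsets. -/
noncomputable abbrev downFinsetFintype [Fintype α] : Fintype (DownFinset α) :=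
  Subtype.fintype _

attribute [local instance] downFinsetFintype

theorem mem_inf_downFinset {S T : DownFinset α} {x : α} :
    x ∈ (S ⊓ T).1 ↔ x ∈ S.1 ∧ x ∈ T.1 :=
  mem_inter

theorem mem_sup_downFinset {S T : DownFinset α} {x : α} :
    x ∈ (S ⊔ T).1 ↔ x ∈ S.1 ∨ x ∈ T.1 :=
  mem_union

theorem mem_complPairs_downFinset [Fintype α] {A B : DownFinset α}
    {p : DownFinset α × DownFinset α} :
    p ∈ complPairs A B ↔
      ∀ x, (x ∈ p.1.1 ∧ x ∈ p.2.1 ↔ x ∈ A.1) ∧ (x ∈ p.1.1 ∨ x ∈ p.2.1 ↔ x ∈ B.1) := by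
  rw [mem_complPairs, downFinset_ext_iff, downFinset_ext_iff]
  simp only [mem_inf_downFinset, mem_sup_downFinset, forall_and]

/-- Elements of `p.1` outside `p.2` are incomparable to those of `p.2` outside `p.1`, so the two
linear extensions of a realizer order them oppositely. -/
theorem IsRealizer2.reversed_of_mem_sdiff {σ τ : α → α → Prop} (h : IsRealizer2 σ τ)
    {S T : DownFinset α} {u x : α} (hu : u ∈ S.1 \ T.1) (hx : x ∈ T.1 \ S.1) (hux : σ u x) :
    τ x u := by
  rw [mem_sdiff] at hu hx
  rcases h.2.1.1.total x u with hxu | hxu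
  · exact hxu
  · exact (hu.2 (T.2 ((h.2.2 u x).2 ⟨hux, hxu⟩) hx.1)).elim

/-- Exchange `p.1` and `p.2` outside the part where `q.1` and `q.2` are exchanged. -/
def twist (q p : DownFinset α × DownFinset α) : DownFinset α × DownFinset α :=
  ((p.1 ⊓ q.2) ⊔ (p.2 ⊓ q.1), (p.1 ⊓ q.1) ⊔ (p.2 ⊓ q.2))

variable [Fintype α]

theorem twist_mem_complPairs {A B : DownFinset α} {p q : DownFinset α × DownFinset α}
    (hp : p ∈ complPairs A B) (hq : q ∈ complPairs A B) : twist q p ∈ complPairs A B := by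
  rw [mem_complPairs_downFinset] at *
  intro x
  have h₁ := hp x
  have h₂ := hq x
  simp only [twist, mem_inf_downFinset, mem_sup_downFinset]
  tauto

theorem twist_twist {A B : DownFinset α} {p q : DownFinset α × DownFinset α}
    (hp : p ∈ complPairs A B) (hq : q ∈ complPairs A B) : twist q (twist q p) = p := by
  rw [mem_complPairs_downFinset] at hp hq
  refine Prod.ext (downFinset_ext_iff.2 fun x => ?_) (downFinset_ext_iff.2 fun x => ?_) <;>
  · have h₁ := hp x
    have h₂ := hq x
    simp only [twist, mem_inf_downFinset, mem_sup_downFinset]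
    tauto

open Classical in
/-- If two elements are separated by some pair of complements, then a quarter of the ordered pairs
of complements separate them in a prescribed order. -/
theorem card_complPairs_le_of_separated {A B : DownFinset α} {q : DownFinset α × DownFinset α}
    (hq : q ∈ complPairs A B) {m m' : α} (hm : m ∈ q.2.1 \ q.1.1) (hm' : m' ∈ q.1.1 \ q.2.1) :
    #(complPairs A B) ≤
      4 * #{p ∈ complPairs A B | m ∈ p.2.1 \ p.1.1 ∧ m' ∈ p.1.1 \ p.2.1} := by
  set R := {p ∈ complPairs A B | m ∈ p.2.1 \ p.1.1 ∧ m' ∈ p.1.1 \ p.2.1} with hR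
  have hsub : complPairs A B ⊆
      (R ∪ R.image Prod.swap) ∪ (R.image (twist q) ∪ R.image (twist q ∘ Prod.swap)) := by
    intro p hp
    have key : p ∈ R ∨ p.swap ∈ R ∨ twist q p ∈ R ∨ (twist q p).swap ∈ R := by
      simp only [hR, mem_filter, hp, swap_mem_complPairs hp, twist_mem_complPairs hp hq,
        swap_mem_complPairs (twist_mem_complPairs hp hq), true_and]
      rw [mem_complPairs_downFinset] at hp hq
      have h₁ := hp m
      have h₂ := hp m'
      have h₃ := hq m
      have h₄ := hq m'
      rw [mem_sdiff] at hm hm'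
      simp only [twist, mem_sdiff, mem_inf_downFinset, mem_sup_downFinset, Prod.fst_swap,
        Prod.snd_swap]
      grind
    simp only [mem_union, mem_image, Function.comp_apply]
    rcases key with h | h | h | h
    · exact Or.inl (Or.inl h)
    · exact Or.inl (Or.inr ⟨_, h, p.swap_swap⟩)
    · exact Or.inr (Or.inl ⟨_, h, twist_twist hp hq⟩)
    · exact Or.inr (Or.inr ⟨_, h, by rw [Prod.swap_swap, twist_twist hp hq]⟩)
  have h₀ := card_le_card hsub
  have h₁ := card_union_le (R ∪ R.image Prod.swap)
    (R.image (twist q) ∪ R.image (twist q ∘ Prod.swap))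
  have h₂ := card_union_le R (R.image Prod.swap)
  have h₃ := card_union_le (R.image (twist q)) (R.image (twist q ∘ Prod.swap))
  have h₄ : #(R.image Prod.swap) ≤ #R := card_image_le
  have h₅ : #(R.image (twist q)) ≤ #R := card_image_le
  have h₆ : #(R.image (twist q ∘ Prod.swap)) ≤ #R := card_image_le
  omega

/-- If the maxima `m` and `m'` of `S ∆ T` with respect to the two linear extensions of a realizer
both lie in `S`, then cutting `S \ T` at an element `x` of `T \ S` separates them. -/
theorem IsRealizer2.exists_separating_of_mem {σ τ : α → α → Prop} (h : IsRealizer2 σ τ)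
    {S T : DownFinset α} {m m' x : α} (hx : x ∈ T.1 \ S.1) (hm : m ∈ S.1 \ T.1)
    (hm' : m' ∈ S.1 \ T.1) (hmx : σ x m) (hmx' : τ x m') :
    ∃ q ∈ complPairs (S ⊓ T) (S ⊔ T), m ∈ q.2.1 \ q.1.1 ∧ m' ∈ q.1.1 \ q.2.1 := by
  classical
  have hrev := fun u (hu : u ∈ S.1 \ T.1) => h.reversed_of_mem_sdiff hu hx
  obtain ⟨hσ, hτ, hreal⟩ := h
  have hxS := (mem_sdiff.1 hx).2
  have hxne : ∀ u ∈ S.1, u ≠ x := fun u hu hux => hxS (hux ▸ hu)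
  let U : DownFinset α := ⟨T.1 ∪ S.1.filter fun u => σ u x, by
    intro u v hvu hu
    simp only [mem_coe, mem_union, mem_filter] at hu ⊢
    rcases hu with hu | ⟨hu, hux⟩
    · exact Or.inl (T.2 hvu hu)
    · exact Or.inr ⟨S.2 hvu hu, hσ.1.trans _ _ _ (hσ.2 _ _ hvu) hux⟩⟩
  let V : DownFinset α := ⟨S.1.filter fun u => u ∈ T.1 ∨ σ x u, by
    intro u v hvu hu
    simp only [mem_coe, mem_filter] at hu ⊢
    obtain ⟨huS, hu⟩ := hu
    refine ⟨S.2 hvu huS, ?_⟩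
    by_cases hvT : v ∈ T.1
    · exact Or.inl hvT
    refine Or.inr ((hσ.1.total x v).resolve_right fun hvx => ?_)
    have hxv : τ x v := hrev v (mem_sdiff.2 ⟨S.2 hvu huS, hvT⟩) hvx
    rcases hu with huT | hxu
    · exact hvT (T.2 hvu huT)
    · exact hxS (S.2 ((hreal x u).2 ⟨hxu, hτ.1.trans _ _ _ hxv (hτ.2 _ _ hvu)⟩) huS)⟩
  refine ⟨(U, V), mem_complPairs_downFinset.2 fun y => ?_, ?_, ?_⟩
  · simp only [U, V, mem_union, mem_filter, mem_inf_downFinset, mem_sup_downFinset]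
    have h₁ := hσ.1.total x y
    have h₂ : y ∈ S.1 → σ x y → ¬ σ y x := fun hy h₁ h₂ => hxne y hy (hσ.1.antisymm _ _ h₂ h₁)
    tauto
  · rw [mem_sdiff] at hm
    have h₂ : ¬ σ m x := fun h₂ => hxne m hm.1 (hσ.1.antisymm _ _ h₂ hmx)
    simp only [U, V, mem_sdiff, mem_union, mem_filter]
    tauto
  · rw [mem_sdiff] at hm'
    have h₁ : ¬ σ x m' := fun h₁ => hxS (S.2 ((hreal x m').2 ⟨h₁, hmx'⟩) hm'.1)
    have h₂ := hσ.1.total x m'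
    simp only [U, V, mem_sdiff, mem_union, mem_filter]
    tauto

/-- The maxima of the symmetric difference of two incomparable downsets with respect to the two
linear extensions of a realizer are separated by some pair of complements. -/
theorem IsRealizer2.exists_separating {σ τ : α → α → Prop} (h : IsRealizer2 σ τ)
    {S T : DownFinset α} (hST : ¬ S ≤ T) (hTS : ¬ T ≤ S) {m m' : α} (hm : m ∈ S.1 ∆ T.1)
    (hmax : ∀ x ∈ S.1 ∆ T.1, σ x m) (hm' : m' ∈ S.1 ∆ T.1) (hmax' : ∀ x ∈ S.1 ∆ T.1, τ x m') :
    ∃ q ∈ complPairs (S ⊓ T) (S ⊔ T), m ∈ q.2.1 \ q.1.1 ∧ m' ∈ q.1.1 \ q.2.1 := by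
  obtain ⟨y, hyS, hyT⟩ := not_subset.1 hST
  obtain ⟨x, hxT, hxS⟩ := not_subset.1 hTS
  have hy : y ∈ S.1 ∆ T.1 := mem_symmDiff.2 (Or.inl ⟨hyS, hyT⟩)
  have hx : x ∈ S.1 ∆ T.1 := mem_symmDiff.2 (Or.inr ⟨hxT, hxS⟩)
  have hself : (S, T) ∈ complPairs (S ⊓ T) (S ⊔ T) := mem_complPairs.2 ⟨rfl, rfl⟩
  rcases mem_symmDiff.1 hm with hmS | hmT <;> rcases mem_symmDiff.1 hm' with hmS' | hmT'
  · exact h.exists_separating_of_mem (mem_sdiff.2 ⟨hxT, hxS⟩) (mem_sdiff.2 hmS)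
      (mem_sdiff.2 hmS') (hmax x hx) (hmax' x hx)
  · exact ⟨(T, S), swap_mem_complPairs hself, mem_sdiff.2 hmS, mem_sdiff.2 hmT'⟩
  · exact ⟨(S, T), hself, mem_sdiff.2 hmT, mem_sdiff.2 hmS'⟩
  · rw [inf_comm, sup_comm]
    exact h.exists_separating_of_mem (mem_sdiff.2 ⟨hyS, hyT⟩) (mem_sdiff.2 hmT)
      (mem_sdiff.2 hmT') (hmax y hy) (hmax' y hy)

theorem symmDiff_eq_of_mem_complPairs {S T : DownFinset α} {p : DownFinset α × DownFinset α}
    (hp : p ∈ complPairs (S ⊓ T) (S ⊔ T)) : p.1.1 ∆ p.2.1 = S.1 ∆ T.1 := by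
  ext x
  have := mem_complPairs_downFinset.1 hp x
  simp only [mem_inf_downFinset, mem_sup_downFinset] at this
  simp only [mem_symmDiff]
  grind

/-- For incomparable downsets, the two revlex orders of a realizer reverse at least a quarter of the
ordered pairs with the same intersection and union. -/
theorem IsRealizer2.card_complPairs_le {σ τ : α → α → Prop} (h : IsRealizer2 σ τ)
    {S T : DownFinset α} (hST : ¬ S ≤ T) (hTS : ¬ T ≤ S) :
    #(complPairs (S ⊓ T) (S ⊔ T)) ≤
      4 * #(revPairs (DRevLex σ) (DRevLex τ) (S ⊓ T) (S ⊔ T)) := by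
  classical
  have hne : (S.1 ∆ T.1).Nonempty :=
    nonempty_iff_ne_empty.2 fun h0 => hST (symmDiff_eq_bot.1 h0).subset
  obtain ⟨m, hm, hmax⟩ := exists_greatest_of_isLinExt h.1 hne
  obtain ⟨m', hm', hmax'⟩ := exists_greatest_of_isLinExt h.2.1 hne
  obtain ⟨q, hq, hqm, hqm'⟩ := h.exists_separating hST hTS hm hmax hm' hmax'
  refine (card_complPairs_le_of_separated hq hqm hqm').trans ?_
  refine Nat.mul_le_mul_left 4 (card_le_card ?_)
  intro p hp
  obtain ⟨hpX, hpm, hpm'⟩ := mem_filter.1 hp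
  have hsymm := symmDiff_eq_of_mem_complPairs hpX
  refine mem_revPairs.2 ⟨hpX, fun heq => ?_, Or.inr ⟨m, hpm, hsymm ▸ hmax⟩,
    Or.inr ⟨m', hpm', symmDiff_comm p.2.1 p.1.1 ▸ hsymm ▸ hmax'⟩⟩
  rw [heq, mem_sdiff] at hpm
  exact hpm.2 hpm.1

/-- The two revlex orders of a realizer maximize the number of reversals among the pairs with given
intersection and union. -/
theorem IsRealizer2.card_revPairs_le {σ τ : α → α → Prop} (h : IsRealizer2 σ τ)
    {L₁ L₂ : DownFinset α → DownFinset α → Prop} (h₁ : IsLinExt L₁) (h₂ : IsLinExt L₂)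
    (A B : DownFinset α) :
    #(revPairs L₁ L₂ A B) ≤ #(revPairs (DRevLex σ) (DRevLex τ) A B) := by
  rcases (revPairs L₁ L₂ A B).eq_empty_or_nonempty with h0 | ⟨p, hp⟩
  · simp [h0]
  obtain ⟨hST, hTS⟩ := not_le_of_mem_revPairs h₁ h₂ hp
  obtain ⟨rfl, rfl⟩ := mem_complPairs.1 (mem_revPairs.1 hp).1
  have := four_mul_card_revPairs_le h₁ h₂ (p.1 ⊓ p.2) (p.1 ⊔ p.2)
  have := h.card_complPairs_le hST hTS
  omega

theorem IsRealizer2.revCount_le {σ τ : α → α → Prop} (h : IsRealizer2 σ τ)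
    {L₁ L₂ : DownFinset α → DownFinset α → Prop} (h₁ : IsLinExt L₁) (h₂ : IsLinExt L₂) :
    revCount L₁ L₂ ≤ revCount (DRevLex σ) (DRevLex τ) := by
  rw [revCount_eq_sum_card_revPairs, revCount_eq_sum_card_revPairs]
  exact sum_le_sum fun q _ => h.card_revPairs_le h₁ h₂ q.1 q.2

end Revlex

/-- If `{σ, σ̄}` is a realizer of cardinality 2 of a finite poset `P`, then the
σ-revlex and σ̄-revlex linear extensions `L_σ` and `L_σ̄` of `D_P` form a diametral pair. -/
theorem revlex_pair_is_diametral {α : Type*} [Fintype α] [PartialOrder α] [DecidableEq α]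
    (σ σbar : α → α → Prop) (hreal : IsRealizer2 σ σbar) :
    IsLinExt (DRevLex σ) ∧ IsLinExt (DRevLex σbar) ∧
    IsGreatest {d : ℕ | ∃ L₁ L₂ : DownFinset α → DownFinset α → Prop,
        IsLinExt L₁ ∧ IsLinExt L₂ ∧ d = revCount L₁ L₂}
      (revCount (DRevLex σ) (DRevLex σbar)) := by
  refine ⟨isLinExt_dRevLex hreal.1, isLinExt_dRevLex hreal.2.1,
    ⟨_, _, isLinExt_dRevLex hreal.1, isLinExt_dRevLex hreal.2.1, rfl⟩, ?_⟩
  rintro _ ⟨L₁, L₂, h₁, h₂, rfl⟩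
  exact hreal.revCount_le h₁ h₂
end

section
/- Let P be a finite poset admitting a realizer of cardinality 2. Then 4·led(D_P) equals the number of ordered pairs (A,B) of antichains of P such that the induced subposet P[A △ B] has at least two connected components. -/
open Finset
open scoped symmDiff

section LinearExtensions

variable {α : Type*} [PartialOrder α] {σ τ : α → α → Prop}

namespace IsLinExt

lemma rel_refl (h : IsLinExt σ) (x : α) : σ x x := h.2 x x le_rfl

lemma rel_trans (h : IsLinExt σ) {x y z : α} (hxy : σ x y) (hyz : σ y z) : σ x z :=
  h.1.toIsPartialOrder.toIsPreorder.toIsTrans.trans x y z hxy hyz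

lemma rel_antisymm (h : IsLinExt σ) {x y : α} (hxy : σ x y) (hyx : σ y x) : x = y :=
  h.1.toIsPartialOrder.toAntisymm.antisymm x y hxy hyx

lemma rel_total (h : IsLinExt σ) (x y : α) : σ x y ∨ σ y x :=
  h.1.toTotal.total x y

lemma exists_greatest (h : IsLinExt σ) {s : Finset α} (hs : s.Nonempty) :
    ∃ m ∈ s, ∀ x ∈ s, σ x m := by
  induction hs using Finset.Nonempty.cons_induction with
  | singleton a => exact ⟨a, by simp, fun x hx => by simp_all [h.rel_refl]⟩
  | cons a s ha hs ih =>
    obtain ⟨m, hm, hmax⟩ := ih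
    rcases h.rel_total a m with ham | hma
    · exact ⟨m, by simp [hm], fun x hx => by
        rcases Finset.mem_cons.1 hx with rfl | hx
        exacts [ham, hmax x hx]⟩
    · exact ⟨a, by simp, fun x hx => by
        rcases Finset.mem_cons.1 hx with rfl | hx
        exacts [h.rel_refl _, h.rel_trans (hmax x hx) hma]⟩

variable [DecidableEq α]

lemma dRevLexLT_asymm (h : IsLinExt σ) {S T : DownFinset α} (hST : DRevLexLT σ S T) :
    ¬ DRevLexLT σ T S := by
  rintro ⟨k, hk, hkmax⟩
  obtain ⟨m, hm, hmax⟩ := hST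
  simp only [mem_sdiff, mem_symmDiff] at *
  have hkm := hmax k (Or.inl hk)
  have hmk := hkmax m (Or.inl hm)
  cases h.rel_antisymm hkm hmk
  exact hm.2 hk.1

lemma dRevLexLT_trans (h : IsLinExt σ) {S T U : DownFinset α} (hST : DRevLexLT σ S T)
    (hTU : DRevLexLT σ T U) : DRevLexLT σ S U := by
  obtain ⟨m, hm, hmmax⟩ := hST
  obtain ⟨k, hk, hkmax⟩ := hTU
  simp only [mem_sdiff, mem_symmDiff] at hm hmmax hk hkmax
  rcases h.rel_total m k with hmk | hkm
  · refine ⟨k, mem_sdiff.2 ⟨hk.1, fun hkS => ?_⟩, fun x hx => ?_⟩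
    · cases h.rel_antisymm hmk (hmmax k (Or.inl ⟨hkS, hk.2⟩))
      exact hk.2 hm.1
    · rw [mem_symmDiff] at hx
      by_cases hxT : x ∈ T.1
      · rcases hx with hx | hx
        · exact hkmax x (Or.inl ⟨hxT, hx.2⟩)
        · exact h.rel_trans (hmmax x (Or.inr ⟨hxT, hx.2⟩)) hmk
      · rcases hx with hx | hx
        · exact h.rel_trans (hmmax x (Or.inl ⟨hx.1, hxT⟩)) hmk
        · exact hkmax x (Or.inr ⟨hx.1, hxT⟩)
  · have hmU : m ∈ U.1 := by
      by_contra hmU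
      cases h.rel_antisymm hkm (hkmax m (Or.inl ⟨hm.1, hmU⟩))
      exact hk.2 hm.1
    refine ⟨m, mem_sdiff.2 ⟨hmU, hm.2⟩, fun x hx => ?_⟩
    rw [mem_symmDiff] at hx
    by_cases hxT : x ∈ T.1
    · rcases hx with hx | hx
      · exact h.rel_trans (hkmax x (Or.inl ⟨hxT, hx.2⟩)) hkm
      · exact hmmax x (Or.inr ⟨hxT, hx.2⟩)
    · rcases hx with hx | hx
      · exact hmmax x (Or.inl ⟨hx.1, hxT⟩)
      · exact h.rel_trans (hkmax x (Or.inr ⟨hx.1, hxT⟩)) hkm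

/-- The revlex order of a linear extension of `P` is a linear extension of the downset lattice. -/
lemma dRevLex (h : IsLinExt σ) : IsLinExt (DRevLex σ : DownFinset α → DownFinset α → Prop) := by
  refine ⟨{ refl := fun S => Or.inl rfl, trans := ?_, antisymm := ?_, total := ?_ }, ?_⟩
  · rintro S T U (rfl | hST) (rfl | hTU)
    exacts [Or.inl rfl, Or.inr hTU, Or.inr hST, Or.inr (h.dRevLexLT_trans hST hTU)]
  · rintro S T (rfl | hST) (hTS | hTS)
    exacts [rfl, rfl, hTS.symm, (h.dRevLexLT_asymm hST hTS).elim]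
  · intro S T
    by_cases hST : S = T
    · exact Or.inl (Or.inl hST)
    have hne : (S.1 ∆ T.1).Nonempty := by
      rw [nonempty_iff_ne_empty, ← Finset.bot_eq_empty, Ne, symmDiff_eq_bot]
      exact fun he => hST (Subtype.ext he)
    obtain ⟨m, hm, hmax⟩ := h.exists_greatest hne
    rcases mem_symmDiff.1 hm with hm | hm
    · exact Or.inr (Or.inr ⟨m, mem_sdiff.2 hm, fun x hx => hmax x (by rwa [symmDiff_comm])⟩)
    · exact Or.inl (Or.inr ⟨m, mem_sdiff.2 hm, hmax⟩)
  · intro S T hST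
    by_cases hne : S = T
    · exact Or.inl hne
    have hsub : S.1 ⊆ T.1 := hST
    have hd : (T.1 \ S.1).Nonempty := by
      rw [sdiff_nonempty]
      exact fun hTS => hne (Subtype.ext (hsub.antisymm hTS))
    obtain ⟨m, hm, hmax⟩ := h.exists_greatest hd
    refine Or.inr ⟨m, hm, fun x hx => hmax x ?_⟩
    rcases mem_symmDiff.1 hx with hx | hx
    · exact (hx.2 (hsub hx.1)).elim
    · exact mem_sdiff.2 hx

end IsLinExt

end LinearExtensions

section Antichains

variable {α : Type*} [PartialOrder α]

/-- The symmetric difference of two antichains contains no chain of three elements. -/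
lemma not_lt_of_lt_of_mem_symmDiff [DecidableEq α] {A B : Finset α}
    (hA : IsAntichain (· ≤ ·) (A : Set α)) (hB : IsAntichain (· ≤ ·) (B : Set α))
    {x y z : α} (hx : x ∈ A ∆ B) (hy : y ∈ A ∆ B) (hz : z ∈ A ∆ B) (hxy : x < y) : ¬ y < z := by
  intro hyz
  have hxz := hxy.trans hyz
  have key : ∀ {u v}, u < v → ¬ (u ∈ A ∧ v ∈ A) ∧ ¬ (u ∈ B ∧ v ∈ B) := fun huv =>
    ⟨fun h => huv.ne (hA.eq h.1 h.2 huv.le), fun h => huv.ne (hB.eq h.1 h.2 huv.le)⟩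
  have h1 := key hxy
  have h2 := key hyz
  have h3 := key hxz
  rw [mem_symmDiff] at hx hy hz
  tauto

variable [Fintype α]

open Classical in
/-- The downset generated by a finite set. -/
noncomputable def downGen (A : Finset α) : DownFinset α :=
  ⟨univ.filter fun x => ∃ a ∈ A, x ≤ a, fun x y hyx hx => by
    simp only [coe_filter, mem_univ, true_and, Set.mem_ofPred_eq] at hx ⊢
    obtain ⟨a, ha, hxa⟩ := hx
    exact ⟨a, ha, hyx.trans hxa⟩⟩

lemma mem_downGen {A : Finset α} {x : α} : x ∈ (downGen A).1 ↔ ∃ a ∈ A, x ≤ a := by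
  simp [downGen]

lemma downGen_le_downGen {A B : Finset α} (h : ∀ a ∈ A, ∃ b ∈ B, a ≤ b) :
    downGen A ≤ downGen B := by
  intro x hx
  obtain ⟨a, ha, hxa⟩ := mem_downGen.1 hx
  obtain ⟨b, hb, hab⟩ := h a ha
  exact mem_downGen.2 ⟨b, hb, hxa.trans hab⟩

lemma mem_iff_maximal_downGen {A : Finset α} (hA : IsAntichain (· ≤ ·) (A : Set α)) {x : α} :
    x ∈ A ↔ Maximal (· ∈ (downGen A).1) x := by
  constructor
  · refine fun hx => ⟨mem_downGen.2 ⟨x, hx, le_rfl⟩, fun y hy hxy => ?_⟩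
    obtain ⟨a, ha, hya⟩ := mem_downGen.1 hy
    rwa [hA.eq hx ha (hxy.trans hya)]
  · intro hx
    obtain ⟨a, ha, hxa⟩ := mem_downGen.1 hx.prop
    rwa [hx.eq_of_le (mem_downGen.2 ⟨a, ha, le_rfl⟩) hxa]

lemma downGen_injOn : Set.InjOn (downGen (α := α)) {A | IsAntichain (· ≤ ·) (A : Set α)} := by
  intro A hA B hB h
  ext x
  rw [mem_iff_maximal_downGen hA, mem_iff_maximal_downGen hB, h]

lemma exists_antichain_downGen_eq (S : DownFinset α) :
    ∃ A : Finset α, IsAntichain (· ≤ ·) (A : Set α) ∧ downGen A = S := by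
  classical
  refine ⟨S.1.filter (Maximal (· ∈ S.1)), fun x hx y hy hne hxy => ?_, ?_⟩
  · simp only [coe_filter, Set.mem_ofPred_eq] at hx hy
    exact hne (hx.2.eq_of_le hy.1 hxy)
  · ext x
    rw [mem_downGen]
    constructor
    · rintro ⟨a, ha, hxa⟩
      exact S.2 hxa (mem_filter.1 ha).1
    · intro hx
      obtain ⟨a, hxa, ha⟩ := S.1.exists_le_maximal hx
      exact ⟨a, mem_filter.2 ⟨ha.prop, ha⟩, hxa⟩

variable [DecidableEq α]

lemma dRevLexLT_downGen_iff {σ : α → α → Prop} (h : IsLinExt σ) {A B : Finset α}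
    (hA : IsAntichain (· ≤ ·) (A : Set α)) (hB : IsAntichain (· ≤ ·) (B : Set α)) :
    DRevLexLT σ (downGen A) (downGen B) ↔ ∃ m ∈ B \ A, ∀ x ∈ A ∆ B, σ x m := by
  constructor
  · rintro ⟨m, hm, hmax⟩
    simp only [mem_sdiff, mem_symmDiff] at hm hmax ⊢
    have hmA : m ∉ A := fun hmA => hm.2 (mem_downGen.2 ⟨m, hmA, le_rfl⟩)
    have hmB : m ∈ B := by
      obtain ⟨b, hb, hmb⟩ := mem_downGen.1 hm.1
      have hbS : b ∉ (downGen A).1 := fun hbS => hm.2 ((downGen A).2 hmb hbS)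
      have := hmax b (Or.inr ⟨mem_downGen.2 ⟨b, hb, le_rfl⟩, hbS⟩)
      rwa [h.rel_antisymm (h.2 _ _ hmb) this]
    refine ⟨m, ⟨hmB, hmA⟩, fun x hx => ?_⟩
    rcases hx with hx | hx
    · by_cases hxT : x ∈ (downGen B).1
      · obtain ⟨b, hb, hxb⟩ := mem_downGen.1 hxT
        have hbS : b ∉ (downGen A).1 := by
          intro hbS
          obtain ⟨a, ha, hba⟩ := mem_downGen.1 hbS
          have := hA.eq hx.1 ha (hxb.trans hba)
          subst this
          exact hx.2 (le_antisymm hxb hba ▸ hb)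
        exact h.rel_trans (h.2 _ _ hxb) (hmax b (Or.inr ⟨mem_downGen.2 ⟨b, hb, le_rfl⟩, hbS⟩))
      · exact hmax x (Or.inl ⟨mem_downGen.2 ⟨x, hx.1, le_rfl⟩, hxT⟩)
    · by_cases hxS : x ∈ (downGen A).1
      · obtain ⟨a, ha, hxa⟩ := mem_downGen.1 hxS
        have haT : a ∉ (downGen B).1 := by
          intro haT
          obtain ⟨b, hb, hab⟩ := mem_downGen.1 haT
          have := hB.eq hx.1 hb (hxa.trans hab)
          subst this
          exact hx.2 (le_antisymm hxa hab ▸ ha)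
        exact h.rel_trans (h.2 _ _ hxa) (hmax a (Or.inl ⟨mem_downGen.2 ⟨a, ha, le_rfl⟩, haT⟩))
      · exact hmax x (Or.inr ⟨mem_downGen.2 ⟨x, hx.1, le_rfl⟩, hxS⟩)
  · rintro ⟨m, hm, hmax⟩
    simp only [mem_sdiff, mem_symmDiff] at hm hmax
    refine ⟨m, mem_sdiff.2 ⟨mem_downGen.2 ⟨m, hm.1, le_rfl⟩, fun hmS => ?_⟩, fun x hx => ?_⟩
    · obtain ⟨a, ha, hma⟩ := mem_downGen.1 hmS
      by_cases haB : a ∈ B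
      · exact hm.2 (hB.eq hm.1 haB hma ▸ ha)
      · exact hm.2 (h.rel_antisymm (h.2 _ _ hma) (hmax a (Or.inl ⟨ha, haB⟩)) ▸ ha)
    · rcases mem_symmDiff.1 hx with ⟨hxS, hxT⟩ | ⟨hxT, hxS⟩
      · obtain ⟨a, ha, hxa⟩ := mem_downGen.1 hxS
        exact h.rel_trans (h.2 _ _ hxa)
          (hmax a (Or.inl ⟨ha, fun haB => hxT (mem_downGen.2 ⟨a, haB, hxa⟩)⟩))
      · obtain ⟨b, hb, hxb⟩ := mem_downGen.1 hxT
        exact h.rel_trans (h.2 _ _ hxb)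
          (hmax b (Or.inr ⟨hb, fun hbA => hxS (mem_downGen.2 ⟨b, hbA, hxb⟩)⟩))

end Antichains

section Counting

variable {Ω : Type*} [Fintype Ω] [DecidableEq Ω]

lemma two_mul_card_of_compl {F : Finset (Finset Ω)} (hF : ∀ X, Xᶜ ∈ F ↔ X ∉ F) :
    2 * #F = 2 ^ Fintype.card Ω := by
  have h : #(Fᶜ) = #F := by
    refine Finset.card_bij (fun X _ => Xᶜ) (fun X hX => (hF X).2 (mem_compl.1 hX))
      (fun X _ Y _ h => compl_injective h) fun X hX => ⟨Xᶜ, ?_, compl_compl X⟩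
    rwa [mem_compl, ← hF, compl_compl]
  have := F.card_add_card_compl
  rw [h, Fintype.card_finset] at this
  omega

/-- The difference of two self-dual upper families contains at most a quarter of all subsets. -/
lemma four_mul_card_sdiff_le {F G : Finset (Finset Ω)}
    (hF : IsUpperSet (F : Set (Finset Ω))) (hG : IsUpperSet (G : Set (Finset Ω)))
    (hF' : ∀ X, Xᶜ ∈ F ↔ X ∉ F) (hG' : ∀ X, Xᶜ ∈ G ↔ X ∉ G) :
    4 * #(F \ G) ≤ 2 ^ Fintype.card Ω := by
  have hK := hF.le_card_inter_finset hG
  have h1 := two_mul_card_of_compl hF'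
  have h2 := two_mul_card_of_compl hG'
  have h3 := card_sdiff_add_card_inter F G
  have hpos : 0 < 2 ^ Fintype.card Ω := by positivity
  have h4 : #G = #F := by omega
  rw [h4, ← h1] at hK
  have h5 : #F ≤ 2 * #(F ∩ G) := by
    refine le_of_mul_le_mul_left (a := #F) ?_ (by omega)
    linarith
  omega

lemma four_mul_card_filter_notMem_mem {a b : Ω} (hab : a ≠ b) :
    4 * #(univ.filter fun X : Finset Ω => a ∉ X ∧ b ∈ X) = 2 ^ Fintype.card Ω := by
  have h : (univ.filter fun X : Finset Ω => a ∉ X ∧ b ∈ X) = Icc {b} {a}ᶜ := by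
    ext X
    simp [and_comm, Finset.subset_compl_comm (s := X)]
  have hsub : ({b} : Finset Ω) ⊆ {a}ᶜ := by simpa using hab
  have h2 : 2 ≤ Fintype.card Ω := Fintype.one_lt_card_iff.2 ⟨a, b, hab⟩
  rw [h, card_Icc_finset hsub, card_compl, card_singleton, card_singleton]
  obtain ⟨n, hn⟩ := Nat.exists_eq_add_of_le h2
  rw [hn, show 2 + n - 1 - 1 = n by omega, pow_add]
  norm_num

end Counting

section Components

variable {α : Type*} [PartialOrder α]

lemma connectedComponentMk_eq_of_le {D : Set α} {x y : D} (h : (x : α) ≤ y) :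
    (compGraph D).connectedComponentMk x = (compGraph D).connectedComponentMk y := by
  by_cases hxy : x = y
  · rw [hxy]
  · exact SimpleGraph.ConnectedComponent.connectedComponentMk_eq_of_adj
      ((SimpleGraph.fromRel_adj _ _ _).2 ⟨hxy, Or.inl h⟩)

lemma iff_of_connectedComponentMk_eq {D : Set α} {p : D → Prop}
    (hp : ∀ x y : D, (x : α) < y → (p x ↔ p y)) {x y : D}
    (h : (compGraph D).connectedComponentMk x = (compGraph D).connectedComponentMk y) :
    p x ↔ p y := by
  obtain ⟨w⟩ := SimpleGraph.ConnectedComponent.exact h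
  clear h
  induction w with
  | nil => rfl
  | @cons u v w huv _ ih =>
    refine Iff.trans ?_ ih
    obtain ⟨hne, hle | hle⟩ := (SimpleGraph.fromRel_adj _ _ _).1 huv
    · exact hp _ _ (lt_of_le_of_ne hle fun h => hne (Subtype.ext h))
    · exact (hp _ _ (lt_of_le_of_ne hle fun h => hne (Subtype.ext h.symm))).symm

/-- If `D` is disconnected, then the greatest elements of `D` with respect to the two linear
extensions of a realizer lie in different components. -/
lemma connectedComponentMk_ne_of_isRealizer2 {σ τ : α → α → Prop} (h : IsRealizer2 σ τ)
    {D : Set α} (hD : 2 ≤ numComponents D) {m n : D} (hm : ∀ x ∈ D, σ x m)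
    (hn : ∀ x ∈ D, τ x n) :
    (compGraph D).connectedComponentMk m ≠ (compGraph D).connectedComponentMk n := by
  obtain ⟨hσ, hτ, hr⟩ := h
  intro hmn
  have : Finite (compGraph D).ConnectedComponent := Nat.finite_of_card_ne_zero (by
    unfold numComponents at hD; omega)
  have : Nontrivial (compGraph D).ConnectedComponent :=
    Finite.one_lt_card_iff_nontrivial.1 hD
  obtain ⟨K, hK⟩ := exists_ne ((compGraph D).connectedComponentMk m)
  obtain ⟨x, rfl⟩ := K.nonempty_supp
  have hx : ∀ y : D, (compGraph D).connectedComponentMk y =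
      (compGraph D).connectedComponentMk m → ¬ (x : α) ≤ y ∧ ¬ (y : α) ≤ x := fun y hy =>
    ⟨fun hle => hK ((connectedComponentMk_eq_of_le hle).trans hy),
      fun hle => hK ((connectedComponentMk_eq_of_le hle).symm.trans hy)⟩
  have key : ((compGraph D).connectedComponentMk m = (compGraph D).connectedComponentMk m →
      σ x m) ↔ ((compGraph D).connectedComponentMk n = (compGraph D).connectedComponentMk m →
      σ x n) := by
    refine iff_of_connectedComponentMk_eq (p := fun y =>
      (compGraph D).connectedComponentMk y = (compGraph D).connectedComponentMk m → σ x y)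
      (fun y z hyz => ?_) hmn
    have hcomp := connectedComponentMk_eq_of_le hyz.le
    rw [hcomp]
    refine imp_congr_right fun hz => ⟨fun hxy => hσ.rel_trans hxy (hσ.2 _ _ hyz.le), fun hxz => ?_⟩
    by_contra hxy
    have hyx := (hσ.rel_total x y).resolve_left hxy
    have hxy' : τ x y := (hτ.rel_total x y).resolve_right fun h' =>
      (hx y (hcomp.trans hz)).2 ((hr _ _).2 ⟨hyx, h'⟩)
    exact (hx z hz).1 ((hr _ _).2 ⟨hxz, hτ.rel_trans hxy' (hτ.2 _ _ hyz.le)⟩)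
  have hxn := key.1 (fun _ => hm x x.2) hmn.symm
  exact (hx n hmn.symm).1 ((hr _ _).2 ⟨hxn, hn x x.2⟩)

end Components

section Resplit

variable {α : Type*} [Fintype α] [PartialOrder α] [DecidableEq α]

open Classical in
/-- Redistribute the symmetric difference of `A` and `B`: keep `A ∩ B`, take the maximal elements
of the components of `A ∆ B` that belong to `X`, and the nonmaximal elements of the others. -/
noncomputable def resplit (A B : Finset α)
    (X : Finset (compGraph (↑(A ∆ B) : Set α)).ConnectedComponent) : Finset α :=
  univ.filter fun d => (d ∈ A ∧ d ∈ B) ∨ ∃ h : d ∈ A ∆ B,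
    ((∀ e ∈ A ∆ B, ¬ d < e) ↔ (compGraph (↑(A ∆ B) : Set α)).connectedComponentMk ⟨d, h⟩ ∈ X)

variable {A B : Finset α} {X Y : Finset (compGraph (↑(A ∆ B) : Set α)).ConnectedComponent}

lemma mem_resplit_of_mem {d : α} (hA : d ∈ A) (hB : d ∈ B) : d ∈ resplit A B X := by
  simp [resplit, hA, hB]

lemma mem_of_mem_resplit {d : α} (hd : d ∈ resplit A B X) (hD : d ∉ A ∆ B) : d ∈ A ∧ d ∈ B := by
  simp only [resplit, mem_filter, mem_univ, true_and] at hd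
  exact hd.resolve_right fun h => hD h.1

lemma mem_resplit_iff {d : α} (h : d ∈ A ∆ B) :
    d ∈ resplit A B X ↔ ((∀ e ∈ A ∆ B, ¬ d < e) ↔
      (compGraph (↑(A ∆ B) : Set α)).connectedComponentMk ⟨d, h⟩ ∈ X) := by
  have h' : ¬ (d ∈ A ∧ d ∈ B) := by
    rw [mem_symmDiff] at h
    tauto
  simp only [resplit, mem_filter, mem_univ, true_and, h', false_or, h, exists_true_left]

lemma resplit_injective : Function.Injective (resplit A B) := by
  intro X Y h
  ext K
  obtain ⟨⟨d, hd⟩, rfl⟩ := K.nonempty_supp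
  have := congrArg (d ∈ ·) h
  simp only [mem_resplit_iff hd, eq_iff_iff] at this
  tauto

lemma isAntichain_resplit (hA : IsAntichain (· ≤ ·) (A : Set α))
    (hB : IsAntichain (· ≤ ·) (B : Set α)) : IsAntichain (· ≤ ·) (resplit A B X : Set α) := by
  intro x hx y hy hne hxy
  have hAB : ∀ {d}, d ∈ resplit A B X → d ∈ A ∨ d ∈ B := by
    intro d hd
    by_cases hD : d ∈ A ∆ B
    · rw [mem_symmDiff] at hD
      tauto
    · exact Or.inl (mem_of_mem_resplit hd hD).1
  by_cases hxD : x ∈ A ∆ B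
  · by_cases hyD : y ∈ A ∆ B
    · rw [mem_coe, mem_resplit_iff hxD] at hx
      rw [mem_coe, mem_resplit_iff hyD] at hy
      have hlt := lt_of_le_of_ne hxy hne
      have hmk := connectedComponentMk_eq_of_le (D := (↑(A ∆ B) : Set α))
        (x := ⟨x, hxD⟩) (y := ⟨y, hyD⟩) hxy
      rw [hmk, ← hy] at hx
      exact hx.2 (fun e he => not_lt_of_lt_of_mem_symmDiff hA hB hxD hyD he hlt) y hyD hlt
    · obtain ⟨hyA, hyB⟩ := mem_of_mem_resplit hy hyD
      rcases hAB hx with h | h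
      exacts [hne (hA.eq h hyA hxy), hne (hB.eq h hyB hxy)]
  · obtain ⟨hxA, hxB⟩ := mem_of_mem_resplit hx hxD
    rcases hAB hy with h | h
    exacts [hne (hA.eq hxA h hxy), hne (hB.eq hxB h hxy)]

lemma downGen_resplit_mono (hA : IsAntichain (· ≤ ·) (A : Set α))
    (hB : IsAntichain (· ≤ ·) (B : Set α)) (hXY : X ⊆ Y) :
    downGen (resplit A B X) ≤ downGen (resplit A B Y) := by
  refine downGen_le_downGen fun d hd => ?_
  by_cases hD : d ∈ A ∆ B
  · by_cases hdY : d ∈ resplit A B Y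
    · exact ⟨d, hdY, le_rfl⟩
    rw [mem_resplit_iff hD] at hd hdY
    have hXY' := @hXY ((compGraph (↑(A ∆ B) : Set α)).connectedComponentMk ⟨d, hD⟩)
    by_cases htop : ∀ e ∈ A ∆ B, ¬ d < e
    · tauto
    · have hmem : (compGraph (↑(A ∆ B) : Set α)).connectedComponentMk ⟨d, hD⟩ ∈ Y := by tauto
      push Not at htop
      obtain ⟨e, he, hde⟩ := htop
      refine ⟨e, (mem_resplit_iff he).2 (iff_of_true
        (fun f hf => not_lt_of_lt_of_mem_symmDiff hA hB hD he hf hde) ?_), hde.le⟩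
      rwa [← connectedComponentMk_eq_of_le (D := (↑(A ∆ B) : Set α))
        (x := ⟨d, hD⟩) (y := ⟨e, he⟩) hde.le]
  · obtain ⟨h1, h2⟩ := mem_of_mem_resplit hd hD
    exact ⟨d, mem_resplit_of_mem h1 h2, le_rfl⟩

lemma exists_resplit_eq {A' B' : Finset α} (hA : IsAntichain (· ≤ ·) (A' : Set α))
    (hB : IsAntichain (· ≤ ·) (B' : Set α)) (hinter : A' ∩ B' = A ∩ B)
    (hsymm : A' ∆ B' = A ∆ B) [Fintype (compGraph (↑(A ∆ B) : Set α)).ConnectedComponent] :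
    ∃ X, resplit A B X = A' := by
  classical
  have hlocal : ∀ x y : (↑(A ∆ B) : Set α), (x : α) < y →
      (((x : α) ∈ A' ↔ ∀ e ∈ A ∆ B, ¬ (x : α) < e) ↔
        ((y : α) ∈ A' ↔ ∀ e ∈ A ∆ B, ¬ (y : α) < e)) := by
    rintro ⟨x, hx⟩ ⟨y, hy⟩ hxy
    simp only [mem_coe] at hx hy hxy ⊢
    rw [← hsymm] at hx hy ⊢
    have h1 : ∀ e ∈ A' ∆ B', ¬ y < e := fun e he =>
      not_lt_of_lt_of_mem_symmDiff hA hB hx hy he hxy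
    have h2 : ¬ ∀ e ∈ A' ∆ B', ¬ x < e := fun h => h y hy hxy
    have h3 : ¬ (x ∈ A' ∧ y ∈ A') := fun h => hxy.ne (hA.eq h.1 h.2 hxy.le)
    have h4 : ¬ (x ∈ B' ∧ y ∈ B') := fun h => hxy.ne (hB.eq h.1 h.2 hxy.le)
    rw [mem_symmDiff] at hx hy
    tauto
  refine ⟨univ.filter fun K => ∃ x : (↑(A ∆ B) : Set α),
    (compGraph (↑(A ∆ B) : Set α)).connectedComponentMk x = K ∧
      ((x : α) ∈ A' ↔ ∀ e ∈ A ∆ B, ¬ (x : α) < e), ?_⟩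
  ext d
  by_cases hD : d ∈ A ∆ B
  · rw [mem_resplit_iff hD, mem_filter]
    have hK : (∃ x : (↑(A ∆ B) : Set α), (compGraph (↑(A ∆ B) : Set α)).connectedComponentMk x =
        (compGraph (↑(A ∆ B) : Set α)).connectedComponentMk ⟨d, hD⟩ ∧
        ((x : α) ∈ A' ↔ ∀ e ∈ A ∆ B, ¬ (x : α) < e)) ↔ (d ∈ A' ↔ ∀ e ∈ A ∆ B, ¬ d < e) :=
      ⟨fun ⟨x, hx, hx'⟩ => (iff_of_connectedComponentMk_eq hlocal hx).1 hx',
        fun h => ⟨⟨d, hD⟩, rfl, h⟩⟩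
    rw [hK]
    simp only [mem_univ, true_and]
    tauto
  · have h1 : d ∈ A' ∧ d ∈ B' ↔ d ∈ A ∧ d ∈ B := by
      rw [← mem_inter, hinter, mem_inter]
    have h2 : d ∉ A' ∆ B' := hsymm ▸ hD
    rw [mem_symmDiff] at h2
    constructor
    · exact fun h => (h1.2 (mem_of_mem_resplit h hD)).1
    · intro h
      have := h1.1 (by tauto)
      exact mem_resplit_of_mem this.1 this.2

variable [Fintype (compGraph (↑(A ∆ B) : Set α)).ConnectedComponent]
  [DecidableEq (compGraph (↑(A ∆ B) : Set α)).ConnectedComponent]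

lemma mem_resplit_compl_iff {d : α} (h : d ∈ A ∆ B) :
    d ∈ resplit A B Xᶜ ↔ d ∉ resplit A B X := by
  rw [mem_resplit_iff h, mem_resplit_iff h, mem_compl]
  tauto

lemma resplit_inter_resplit_compl : resplit A B X ∩ resplit A B Xᶜ = A ∩ B := by
  ext d
  rw [mem_inter, mem_inter]
  by_cases hD : d ∈ A ∆ B
  · rw [mem_resplit_compl_iff hD]
    rw [mem_symmDiff] at hD
    tauto
  · exact ⟨fun h => mem_of_mem_resplit h.1 hD,
      fun h => ⟨mem_resplit_of_mem h.1 h.2, mem_resplit_of_mem h.1 h.2⟩⟩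

lemma resplit_symmDiff_resplit_compl : resplit A B X ∆ resplit A B Xᶜ = A ∆ B := by
  ext d
  by_cases hD : d ∈ A ∆ B
  · rw [mem_symmDiff, mem_resplit_compl_iff hD]
    tauto
  · simp only [hD, iff_false, mem_symmDiff]
    rintro (⟨h, h'⟩ | ⟨h, h'⟩)
    all_goals
      obtain ⟨hA, hB⟩ := mem_of_mem_resplit h hD
      exact h' (mem_resplit_of_mem hA hB)

end Resplit

section Reversals

variable {α : Type*} [Fintype α] [PartialOrder α]

open Classical in
/-- The ordered pairs of antichains. -/
noncomputable def antichainPairs (α : Type*) [Fintype α] [PartialOrder α] :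
    Finset (Finset α × Finset α) :=
  univ.filter fun p => IsAntichain (· ≤ ·) (p.1 : Set α) ∧ IsAntichain (· ≤ ·) (p.2 : Set α)

lemma mem_antichainPairs {p : Finset α × Finset α} : p ∈ antichainPairs α ↔
    IsAntichain (· ≤ ·) (p.1 : Set α) ∧ IsAntichain (· ≤ ·) (p.2 : Set α) := by
  simp [antichainPairs]

/-- The downsets generated by `p.1` and `p.2` form a reversal between `L₁` and `L₂`. -/
def IsReversal (L₁ L₂ : DownFinset α → DownFinset α → Prop) (p : Finset α × Finset α) : Prop :=
  downGen p.1 ≠ downGen p.2 ∧ L₁ (downGen p.1) (downGen p.2) ∧ L₂ (downGen p.2) (downGen p.1)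

open Classical in
lemma revCount_eq_card (L₁ L₂ : DownFinset α → DownFinset α → Prop) :
    revCount L₁ L₂ = #((antichainPairs α).filter (IsReversal L₁ L₂)) := by
  rw [← Set.ncard_coe_finset, revCount]
  symm
  refine Set.ncard_congr (fun p _ => (downGen p.1, downGen p.2)) ?_ ?_ ?_
  · intro p hp
    exact (mem_filter.1 hp).2
  · intro p q hp hq h
    have hp := mem_antichainPairs.1 (mem_filter.1 hp).1
    have hq := mem_antichainPairs.1 (mem_filter.1 hq).1
    rw [Prod.mk.injEq] at h
    exact Prod.ext (downGen_injOn hp.1 hq.1 h.1) (downGen_injOn hp.2 hq.2 h.2)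
  · rintro ⟨S, T⟩ h
    obtain ⟨A, hA, rfl⟩ := exists_antichain_downGen_eq S
    obtain ⟨B, hB, rfl⟩ := exists_antichain_downGen_eq T
    exact ⟨(A, B), mem_coe.2 (mem_filter.2 ⟨mem_antichainPairs.2 ⟨hA, hB⟩, h⟩), rfl⟩

variable [DecidableEq α]

/-- The pairs of antichains with prescribed intersection and symmetric difference. -/
noncomputable def antichainFiber (C D : Finset α) : Finset (Finset α × Finset α) :=
  (antichainPairs α).filter fun p => (p.1 ∩ p.2, p.1 ∆ p.2) = (C, D)

lemma mul_card_filter_le_of_antichainFiber {P Q : Finset α × Finset α → Prop}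
    [DecidablePred P] [DecidablePred Q] {a b : ℕ}
    (h : ∀ A B : Finset α, IsAntichain (· ≤ ·) (A : Set α) → IsAntichain (· ≤ ·) (B : Set α) →
      a * #((antichainFiber (A ∩ B) (A ∆ B)).filter P) ≤
        b * #((antichainFiber (A ∩ B) (A ∆ B)).filter Q)) :
    a * #((antichainPairs α).filter P) ≤ b * #((antichainPairs α).filter Q) := by
  rw [card_eq_sum_card_fiberwise (s := (antichainPairs α).filter P)
      (f := fun p => (p.1 ∩ p.2, p.1 ∆ p.2)) (t := univ) (fun _ _ => mem_univ _),
    card_eq_sum_card_fiberwise (s := (antichainPairs α).filter Q)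
      (f := fun p => (p.1 ∩ p.2, p.1 ∆ p.2)) (t := univ) (fun _ _ => mem_univ _),
    mul_sum, mul_sum]
  refine sum_le_sum fun q _ => ?_
  rw [filter_comm, filter_comm (p := Q)]
  change a * #((antichainFiber q.1 q.2).filter P) ≤ b * #((antichainFiber q.1 q.2).filter Q)
  by_cases hne : (antichainFiber q.1 q.2).Nonempty
  · obtain ⟨p, hp⟩ := hne
    obtain ⟨hp, hpq⟩ := mem_filter.1 hp
    rw [Prod.mk.injEq] at hpq
    rw [← hpq.1, ← hpq.2]
    exact h _ _ (mem_antichainPairs.1 hp).1 (mem_antichainPairs.1 hp).2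
  · rw [not_nonempty_iff_eq_empty.1 hne]
    simp

variable {A B : Finset α} [Fintype (compGraph (↑(A ∆ B) : Set α)).ConnectedComponent]
  [DecidableEq (compGraph (↑(A ∆ B) : Set α)).ConnectedComponent]

lemma antichainFiber_eq_image (hA : IsAntichain (· ≤ ·) (A : Set α))
    (hB : IsAntichain (· ≤ ·) (B : Set α)) : antichainFiber (A ∩ B) (A ∆ B) =
      univ.image fun X => (resplit A B X, resplit A B Xᶜ) := by
  ext ⟨A', B'⟩
  simp only [antichainFiber, mem_filter, mem_antichainPairs, mem_image, mem_univ, true_and,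
    Prod.mk.injEq]
  constructor
  · rintro ⟨⟨hA', hB'⟩, hinter, hsymm⟩
    obtain ⟨X, hX⟩ := exists_resplit_eq hA' hB' hinter hsymm
    refine ⟨X, hX, symmDiff_right_injective A' ?_⟩
    change A' ∆ _ = A' ∆ B'
    rw [hsymm, ← hX]
    exact resplit_symmDiff_resplit_compl
  · rintro ⟨X, rfl, rfl⟩
    exact ⟨⟨isAntichain_resplit hA hB, isAntichain_resplit hA hB⟩,
      resplit_inter_resplit_compl, resplit_symmDiff_resplit_compl⟩

lemma card_filter_antichainFiber (hA : IsAntichain (· ≤ ·) (A : Set α))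
    (hB : IsAntichain (· ≤ ·) (B : Set α)) (P : Finset α × Finset α → Prop) [DecidablePred P] :
    #((antichainFiber (A ∩ B) (A ∆ B)).filter P) =
      #(univ.filter fun X => P (resplit A B X, resplit A B Xᶜ)) := by
  rw [antichainFiber_eq_image hA hB, filter_image, card_image_of_injective]
  exact fun X Y h => resplit_injective (Prod.ext_iff.1 h).1

lemma card_filter_numComponents (hA : IsAntichain (· ≤ ·) (A : Set α))
    (hB : IsAntichain (· ≤ ·) (B : Set α)) :
    #((antichainFiber (A ∩ B) (A ∆ B)).filter fun p : Finset α × Finset α =>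
        2 ≤ numComponents (↑(p.1 ∆ p.2) : Set α)) =
      if 2 ≤ numComponents (↑(A ∆ B) : Set α) then
        2 ^ Fintype.card (compGraph (↑(A ∆ B) : Set α)).ConnectedComponent else 0 := by
  rw [card_filter_antichainFiber hA hB]
  simp only [resplit_symmDiff_resplit_compl]
  split_ifs with h <;> simp [h, -coe_symmDiff]

open Classical in
lemma four_mul_card_isReversal_le {L₁ L₂ : DownFinset α → DownFinset α → Prop}
    (h₁ : IsLinExt L₁) (h₂ : IsLinExt L₂) (hA : IsAntichain (· ≤ ·) (A : Set α))
    (hB : IsAntichain (· ≤ ·) (B : Set α)) :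
    4 * #(univ.filter fun X => IsReversal L₁ L₂ (resplit A B X, resplit A B Xᶜ)) ≤
      2 ^ Fintype.card (compGraph (↑(A ∆ B) : Set α)).ConnectedComponent := by
  have hinj : ∀ X, downGen (resplit A B X) = downGen (resplit A B Xᶜ) → A ∆ B = ∅ := by
    intro X h
    rw [← resplit_symmDiff_resplit_compl (X := X),
      downGen_injOn (isAntichain_resplit hA hB) (isAntichain_resplit hA hB) h]
    exact symmDiff_self _
  by_cases hD : A ∆ B = ∅
  · have : (univ.filter fun X => IsReversal L₁ L₂ (resplit A B X, resplit A B Xᶜ)) = ∅ := by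
      refine filter_eq_empty_iff.2 fun X _ hX => hX.1 ?_
      have := (resplit_symmDiff_resplit_compl (X := X)).trans hD
      rw [← Finset.bot_eq_empty, symmDiff_eq_bot] at this
      exact congrArg downGen this
    rw [this]
    simp
  have hupper : ∀ {L : DownFinset α → DownFinset α → Prop}, IsLinExt L → IsUpperSet
      (↑(univ.filter fun X => L (downGen (resplit A B Xᶜ)) (downGen (resplit A B X))) :
        Set (Finset (compGraph (↑(A ∆ B) : Set α)).ConnectedComponent)) := by
    intro L hL X Y hXY hX
    simp only [coe_filter, mem_univ, true_and, Set.mem_ofPred_eq] at hX ⊢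
    exact hL.rel_trans (hL.2 _ _ (downGen_resplit_mono hA hB (compl_subset_compl.2 hXY)))
      (hL.rel_trans hX (hL.2 _ _ (downGen_resplit_mono hA hB hXY)))
  have hcompl : ∀ {L : DownFinset α → DownFinset α → Prop}, IsLinExt L → ∀ X,
      Xᶜ ∈ (univ.filter fun X => L (downGen (resplit A B Xᶜ)) (downGen (resplit A B X))) ↔
      X ∉ (univ.filter fun X => L (downGen (resplit A B Xᶜ)) (downGen (resplit A B X))) := by
    intro L hL X
    simp only [mem_filter, mem_univ, true_and, compl_compl]
    exact ⟨fun h h' => hD (hinj X (hL.rel_antisymm h h')),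
      fun h => (hL.rel_total _ _).resolve_right h⟩
  refine le_trans ?_ (four_mul_card_sdiff_le (hupper h₂) (hupper h₁) (hcompl h₂) (hcompl h₁))
  refine Nat.mul_le_mul_left 4 (card_le_card fun X hX => ?_)
  obtain ⟨hne, hX₁, hX₂⟩ := (mem_filter.1 hX).2
  rw [mem_sdiff, ← hcompl h₁]
  simpa using ⟨hX₂, hX₁⟩

open Classical in
lemma four_mul_card_isReversal_dRevLex {σ τ : α → α → Prop} (h : IsRealizer2 σ τ)
    (hA : IsAntichain (· ≤ ·) (A : Set α)) (hB : IsAntichain (· ≤ ·) (B : Set α))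
    (hc : 2 ≤ numComponents (↑(A ∆ B) : Set α)) :
    4 * #(univ.filter fun X =>
        IsReversal (DRevLex σ) (DRevLex τ) (resplit A B X, resplit A B Xᶜ)) =
      2 ^ Fintype.card (compGraph (↑(A ∆ B) : Set α)).ConnectedComponent := by
  have hne : (A ∆ B).Nonempty := by
    rw [nonempty_iff_ne_empty]
    intro h0
    have : IsEmpty (↑(A ∆ B) : Set α) := by simp [h0]
    have : IsEmpty (compGraph (↑(A ∆ B) : Set α)).ConnectedComponent :=
      ⟨fun K => K.nonempty_supp.elim fun x _ => this.false x⟩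
    simp [numComponents] at hc
  obtain ⟨m, hm, hmmax⟩ := h.1.exists_greatest hne
  obtain ⟨n, hn, hnmax⟩ := h.2.1.exists_greatest hne
  have hmn := connectedComponentMk_ne_of_isRealizer2 h hc (m := ⟨m, hm⟩) (n := ⟨n, hn⟩)
    hmmax hnmax
  rw [← four_mul_card_filter_notMem_mem hmn]
  congr 2
  ext X
  simp only [mem_filter, mem_univ, true_and]
  have hrev : ∀ {ρ : α → α → Prop} {k : α}, IsLinExt ρ → k ∈ A ∆ B → (∀ x ∈ A ∆ B, ρ x k) →
      ∀ Y, DRevLexLT ρ (downGen (resplit A B Y)) (downGen (resplit A B Yᶜ)) ↔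
        k ∉ resplit A B Y := by
    intro ρ k hρ hk hmax Y
    rw [dRevLexLT_downGen_iff hρ (isAntichain_resplit hA hB) (isAntichain_resplit hA hB),
      resplit_symmDiff_resplit_compl]
    constructor
    · rintro ⟨l, hl, hlmax⟩
      have hlD : l ∈ A ∆ B := by
        rw [← resplit_symmDiff_resplit_compl (X := Y), mem_symmDiff]
        exact Or.inr (mem_sdiff.1 hl)
      rw [hρ.rel_antisymm (hlmax k hk) (hmax l hlD)]
      exact (mem_sdiff.1 hl).2
    · exact fun hkY => ⟨k, mem_sdiff.2 ⟨(mem_resplit_compl_iff hk).2 hkY, hkY⟩, hmax⟩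
  have hσ := hrev h.1 hm hmmax X
  have hτ := hrev h.2.1 hn hnmax Xᶜ
  rw [compl_compl] at hτ
  have hmtop : ∀ e ∈ A ∆ B, ¬ m < e := fun e he hlt =>
    hlt.ne (h.1.rel_antisymm (h.1.2 _ _ hlt.le) (hmmax e he))
  have hntop : ∀ e ∈ A ∆ B, ¬ n < e := fun e he hlt =>
    hlt.ne (h.2.1.rel_antisymm (h.2.1.2 _ _ hlt.le) (hnmax e he))
  rw [mem_resplit_iff hm, iff_true_left hmtop] at hσ
  rw [mem_resplit_iff hn, iff_true_left hntop, mem_compl, not_not] at hτ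
  rw [← hσ, ← hτ]
  have hirr : ∀ S : DownFinset α, ¬ DRevLexLT σ S S := fun S ⟨x, hx, _⟩ => by simp at hx
  constructor
  · rintro ⟨hne, h1, h2⟩
    exact ⟨h1.resolve_left hne, h2.resolve_left fun he => hne he.symm⟩
  · rintro ⟨h1, h2⟩
    exact ⟨fun he => hirr _ (he ▸ h1), Or.inr h1, Or.inr h2⟩

end Reversals

/-- For a finite poset `P` admitting a realizer of cardinality 2, four times the
linear extension diameter of `D_P` equals the number of ordered pairs `(A,B)` of antichains of
`P` such that `P[A ∆ B]` has at least two connected components. -/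
theorem led_downset_lattice_eq {α : Type*} [Fintype α] [PartialOrder α] [DecidableEq α]
    (h2dim : ∃ τ τ' : α → α → Prop, IsRealizer2 τ τ') :
    ∃ m : ℕ, IsGreatest {d : ℕ | ∃ L₁ L₂ : DownFinset α → DownFinset α → Prop,
        IsLinExt L₁ ∧ IsLinExt L₂ ∧ d = revCount L₁ L₂} m ∧
      4 * m = Set.ncard {p : Finset α × Finset α |
        IsAntichain (· ≤ ·) (↑p.1 : Set α) ∧ IsAntichain (· ≤ ·) (↑p.2 : Set α) ∧
        2 ≤ numComponents (↑(p.1 ∆ p.2) : Set α)} := by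
  classical
  obtain ⟨σ, τ, hr⟩ := h2dim
  set N := {p : Finset α × Finset α |
    IsAntichain (· ≤ ·) (↑p.1 : Set α) ∧ IsAntichain (· ≤ ·) (↑p.2 : Set α) ∧
    2 ≤ numComponents (↑(p.1 ∆ p.2) : Set α)} with hN_def
  have hN : N.ncard = #((antichainPairs α).filter fun p : Finset α × Finset α =>
      2 ≤ numComponents (↑(p.1 ∆ p.2) : Set α)) := by
    rw [← Set.ncard_coe_finset]
    congr 1
    ext p
    simp [hN_def, mem_antichainPairs, and_assoc]
  have hupper : ∀ {L₁ L₂ : DownFinset α → DownFinset α → Prop}, IsLinExt L₁ → IsLinExt L₂ →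
      4 * revCount L₁ L₂ ≤ N.ncard := by
    intro L₁ L₂ h₁ h₂
    rw [hN, revCount_eq_card, ← one_mul (#((antichainPairs α).filter fun p : Finset α × Finset α =>
      2 ≤ numComponents (↑(p.1 ∆ p.2) : Set α)))]
    refine mul_card_filter_le_of_antichainFiber fun A B hA hB => ?_
    have := Fintype.ofFinite (compGraph (↑(A ∆ B) : Set α)).ConnectedComponent
    have hle := four_mul_card_isReversal_le h₁ h₂ hA hB
    rw [one_mul, card_filter_numComponents hA hB, card_filter_antichainFiber hA hB]
    split_ifs with hc
    · exact hle
    · rw [numComponents, Nat.card_eq_fintype_card] at hc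
      have := hle.trans (Nat.pow_le_pow_right two_pos (show _ ≤ 1 by omega))
      omega
  have hlower : N.ncard ≤ 4 * revCount (DRevLex σ) (DRevLex τ) := by
    rw [hN, revCount_eq_card, ← one_mul (#((antichainPairs α).filter fun p : Finset α × Finset α =>
      2 ≤ numComponents (↑(p.1 ∆ p.2) : Set α)))]
    refine mul_card_filter_le_of_antichainFiber fun A B hA hB => ?_
    have := Fintype.ofFinite (compGraph (↑(A ∆ B) : Set α)).ConnectedComponent
    rw [one_mul, card_filter_numComponents hA hB, card_filter_antichainFiber hA hB]
    split_ifs with hc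
    · exact (four_mul_card_isReversal_dRevLex hr hA hB hc).ge
    · exact Nat.zero_le _
  have heq := le_antisymm (hupper hr.1.dRevLex hr.2.1.dRevLex) hlower
  refine ⟨_, ⟨⟨_, _, hr.1.dRevLex, hr.2.1.dRevLex, rfl⟩, ?_⟩, heq⟩
  rintro d ⟨L₁, L₂, h₁, h₂, rfl⟩
  have := hupper h₁ h₂
  omega
end

section
/- Let P be a finite poset admitting a realizer of cardinality 2, and let (L, L̄) be a diametral pair of linear extensions of the downset lattice D_P. Let σ be the linear extension of P determined by the order of the principal downsets in L (i.e. x ≤_σ y iff x↓ ≤_L y↓). Then there is a linear extension σ̄ of P such that {σ, σ̄} is a realizer of P of cardinality 2, L = L_σ, and L̄ = L_σ̄. -/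
open Finset
open scoped symmDiff

section LinearExtension

variable {α : Type*} [PartialOrder α] {L : α → α → Prop}

theorem IsLinExt.trans (h : IsLinExt L) {x y z : α} : L x y → L y z → L x z :=
  h.1.toIsPartialOrder.toIsPreorder.toIsTrans.trans x y z

theorem IsLinExt.antisymm (h : IsLinExt L) {x y : α} : L x y → L y x → x = y :=
  h.1.toIsPartialOrder.toAntisymm.antisymm x y

theorem IsLinExt.total (h : IsLinExt L) (x y : α) : L x y ∨ L y x :=
  h.1.toTotal.total x y

theorem IsLinExt.refl (h : IsLinExt L) (x : α) : L x x :=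
  h.2 x x le_rfl

theorem IsLinExt.exists_max (h : IsLinExt L) {s : Finset α} (hs : s.Nonempty) :
    ∃ m ∈ s, ∀ x ∈ s, L x m := by
  classical
  induction hs using Finset.Nonempty.cons_induction with
  | singleton a => exact ⟨a, by simp, by simpa using h.refl a⟩
  | cons a s ha hs ih =>
    obtain ⟨m, hm, hmax⟩ := ih
    rcases h.total a m with ham | hma
    · exact ⟨m, by simp [hm], by simpa using ⟨ham, hmax⟩⟩
    · exact ⟨a, by simp, by simpa using ⟨h.refl a, fun x hx => h.trans (hmax x hx) hma⟩⟩

variable {σ τ : α → α → Prop}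

theorem not_le_of_reversed {L₁ L₂ : α → α → Prop} (h₁ : IsLinExt L₁)
    (h₂ : IsLinExt L₂) {x y : α} (hne : x ≠ y) (hxy : L₁ x y) (hyx : L₂ y x) :
    ¬ x ≤ y ∧ ¬ y ≤ x :=
  ⟨fun h => hne (h₂.antisymm (h₂.2 _ _ h) hyx), fun h => hne (h₁.antisymm hxy (h₁.2 _ _ h))⟩

/-- Incomparability is expressed by reversal in a realizer. -/
theorem IsRealizer2.reversed (h : IsRealizer2 σ τ) {x y : α} (hxy : ¬ x ≤ y) (hσ : σ x y) :
    τ y x :=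
  (h.2.1.total x y).resolve_left fun hτ => hxy ((h.2.2 x y).2 ⟨hσ, hτ⟩)

theorem IsRealizer2.symm (h : IsRealizer2 σ τ) : IsRealizer2 τ σ :=
  ⟨h.2.1, h.1, fun x y => (h.2.2 x y).trans and_comm⟩

theorem DownFinset.mem_of_le {S : DownFinset α} {x y : α} (h : x ≤ y) (hy : y ∈ S.1) : x ∈ S.1 :=
  S.2 h hy

end LinearExtension

section Reversals

variable {β : Type*}

/-- The meet and the join of a pair. -/
def infSup [Lattice β] (p : β × β) : β × β :=
  (p.1 ⊓ p.2, p.1 ⊔ p.2)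

theorem infSup_swap [Lattice β] (p : β × β) : infSup p.swap = infSup p := by
  simp [infSup, inf_comm, sup_comm]

open Classical in
/-- The pairs with prescribed meet and join. -/
noncomputable def fiber [Lattice β] [Fintype β] (q : β × β) : Finset (β × β) :=
  univ.filter fun p => infSup p = q

open Classical in
/-- The reversed pairs with prescribed meet and join. -/
noncomputable def reversals [Lattice β] [Fintype β] (L₁ L₂ : β → β → Prop) (q : β × β) :
    Finset (β × β) :=
  (fiber q).filter fun p => p.1 ≠ p.2 ∧ L₁ p.1 p.2 ∧ L₂ p.2 p.1

theorem mem_fiber [Lattice β] [Fintype β] {p q : β × β} : p ∈ fiber q ↔ infSup p = q := by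
  simp [fiber]

theorem mem_reversals [Lattice β] [Fintype β] {L₁ L₂ : β → β → Prop} {p q : β × β} :
    p ∈ reversals L₁ L₂ q ↔ infSup p = q ∧ p.1 ≠ p.2 ∧ L₁ p.1 p.2 ∧ L₂ p.2 p.1 := by
  simp [reversals, mem_fiber]

theorem swap_mem_fiber [Lattice β] [Fintype β] {p q : β × β} :
    p.swap ∈ fiber q ↔ p ∈ fiber q := by
  rw [mem_fiber, mem_fiber, infSup_swap]

theorem revCount_eq_sum [Lattice β] [Fintype β] (L₁ L₂ : β → β → Prop) :
    revCount L₁ L₂ = ∑ q : β × β, #(reversals L₁ L₂ q) := by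
  classical
  have h : {p : β × β | p.1 ≠ p.2 ∧ L₁ p.1 p.2 ∧ L₂ p.2 p.1} =
      ↑(univ.filter fun p : β × β => p.1 ≠ p.2 ∧ L₁ p.1 p.2 ∧ L₂ p.2 p.1) := by
    ext; simp
  rw [revCount, h, Set.ncard_coe_finset,
    card_eq_sum_card_fiberwise (f := infSup) (t := univ) (by simp)]
  refine sum_congr rfl fun q _ => congrArg card ?_
  ext p
  simp [mem_reversals, and_comm]

theorem sup_inf_mem_fiber [DistribLattice β] [Fintype β] {p p' q : β × β}
    (h : p ∈ fiber q) (h' : p' ∈ fiber q) : (p.1 ⊔ p'.1, p.2 ⊓ p'.2) ∈ fiber q := by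
  rw [mem_fiber] at *
  obtain ⟨a, b⟩ := p
  obtain ⟨c, d⟩ := p'
  obtain ⟨u, v⟩ := q
  simp only [infSup, Prod.mk.injEq] at *
  obtain ⟨h₁, h₂⟩ := h
  obtain ⟨h₁', h₂'⟩ := h'
  have hub : u ≤ b := h₁ ▸ inf_le_right
  have hud : u ≤ d := h₁' ▸ inf_le_right
  have hav : a ≤ v := h₂ ▸ le_sup_left
  have hcv : c ≤ v := h₂' ▸ le_sup_left
  constructor
  · rw [inf_sup_right, ← inf_assoc, h₁, inf_left_comm, h₁', inf_eq_left.2 hud,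
      inf_eq_right.2 hub, sup_idem]
  · rw [sup_inf_left, sup_right_comm, h₂, sup_assoc, h₂', sup_eq_left.2 hcv,
      sup_eq_right.2 hav, inf_idem]

open Classical in
theorem two_mul_card_fiber_filter [Lattice β] [Fintype β] {L : β → β → Prop} (hL : IsLinExt L)
    {q : β × β} (hq : q.1 ≠ q.2) :
    2 * #((fiber q).filter fun p => L p.2 p.1) = #(fiber q) := by
  rw [← card_filter_add_card_filter_not (s := fiber q) (fun p => L p.2 p.1), two_mul]
  congr 1
  refine card_bij (fun p _ => p.swap) ?_ (fun _ _ _ _ h => Prod.swap_injective h) ?_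
  · intro p hp
    simp only [mem_filter, swap_mem_fiber, Prod.fst_swap, Prod.snd_swap] at hp ⊢
    refine ⟨hp.1, fun h => hq ?_⟩
    have h12 := hL.antisymm h hp.2
    have := mem_fiber.1 hp.1
    rw [← this]
    simp [infSup, h12]
  · intro p hp
    simp only [mem_filter] at hp
    refine ⟨p.swap, ?_, by simp⟩
    simp only [mem_filter, swap_mem_fiber, Prod.fst_swap, Prod.snd_swap]
    exact ⟨hp.1, (hL.total _ _).resolve_right hp.2⟩

open scoped FinsetFamily in
/-- By Daykin's inequality at most a quarter of the ordered pairs with given meet and join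
are reversed. -/
theorem four_mul_card_reversals_le [DistribLattice β] [Fintype β] {L₁ L₂ : β → β → Prop}
    (h₁ : IsLinExt L₁) (h₂ : IsLinExt L₂) (q : β × β) :
    4 * #(reversals L₁ L₂ q) ≤ #(fiber q) := by
  classical
  by_cases hq : q.1 = q.2
  · have : reversals L₁ L₂ q = ∅ := by
      refine eq_empty_of_forall_notMem fun p hp => ?_
      rw [mem_reversals] at hp
      refine hp.2.1 (inf_eq_sup.1 ?_)
      rw [← hp.1] at hq
      exact hq
    simp [this]
  set U := (fiber q).filter fun p => L₁ p.2 p.1 with hU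
  set V := (fiber q).filter fun p => L₂ p.2 p.1 with hV
  have cU : 2 * #U = #(fiber q) := two_mul_card_fiber_filter h₁ hq
  have cV : 2 * #V = #(fiber q) := two_mul_card_fiber_filter h₂ hq
  have hrev : reversals L₁ L₂ q ⊆ V \ U := by
    intro p hp
    rw [mem_reversals] at hp
    simp only [hU, hV, mem_sdiff, mem_filter, mem_fiber]
    exact ⟨⟨hp.1, hp.2.2.2⟩, fun h => hp.2.1 (h₁.antisymm hp.2.2.1 h.2)⟩
  have hcard := card_le_card hrev
  have hsplit := card_sdiff_add_card_inter V U
  let e : β × β ↪ β × βᵒᵈ := ⟨fun p => (p.1, OrderDual.toDual p.2), fun _ _ h => h⟩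
  have hsup : U.map e ⊻ V.map e ⊆ (V ∩ U).map e := by
    simp only [sups_subset_iff, mem_map]
    rintro _ ⟨p, hp, rfl⟩ _ ⟨p', hp', rfl⟩
    simp only [hU, hV, mem_filter] at hp hp'
    refine ⟨(p.1 ⊔ p'.1, p.2 ⊓ p'.2), ?_, rfl⟩
    have hmem := sup_inf_mem_fiber hp.1 hp'.1
    simp only [hU, hV, mem_inter, mem_filter]
    exact ⟨⟨hmem, h₂.trans (h₂.2 _ _ inf_le_right) (h₂.trans hp'.2 (h₂.2 _ _ le_sup_right))⟩,
      hmem, h₁.trans (h₁.2 _ _ inf_le_left) (h₁.trans hp.2 (h₁.2 _ _ le_sup_left))⟩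
  have hinf : U.map e ⊼ V.map e ⊆ (fiber q).map e := by
    simp only [infs_subset_iff, mem_map]
    rintro _ ⟨p, hp, rfl⟩ _ ⟨p', hp', rfl⟩
    simp only [hU, hV, mem_filter] at hp hp'
    refine ⟨(p.1 ⊓ p'.1, p.2 ⊔ p'.2), ?_, rfl⟩
    have hmem := sup_inf_mem_fiber (swap_mem_fiber.2 hp.1) (swap_mem_fiber.2 hp'.1)
    exact swap_mem_fiber.1 hmem
  have hd := (U.map e).le_card_infs_mul_card_sups (V.map e)
  have hd' := hd.trans (Nat.mul_le_mul (card_le_card hinf) (card_le_card hsup))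
  simp only [card_map] at hd'
  have hUV : #U = #V := by omega
  rcases Nat.eq_zero_or_pos #V with h0 | hpos
  · omega
  · have : #V * #V ≤ #V * (2 * #(V ∩ U)) := by nlinarith
    have := Nat.le_of_mul_le_mul_left this hpos
    omega

end Reversals

section Downsets

variable {α : Type*} [PartialOrder α] [DecidableEq α]

instance : DistribLattice (DownFinset α) :=
  { Subtype.lattice (P := fun S : Finset α => IsLowerSet (↑S : Set α))
      (fun S T hS hT => by simpa using hS.union hT)
      (fun S T hS hT => by simpa using hS.inter hT) with
    le_sup_inf := fun S T U =>
      show (S.1 ⊔ T.1) ⊓ (S.1 ⊔ U.1) ≤ S.1 ⊔ T.1 ⊓ U.1 from le_sup_inf }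

noncomputable instance [Finite α] : Fintype (DownFinset α) :=
  haveI := Fintype.ofFinite α
  Fintype.ofFinite _

theorem DownFinset.coe_inf (S T : DownFinset α) : (S ⊓ T).1 = S.1 ∩ T.1 := rfl

theorem DownFinset.coe_sup (S T : DownFinset α) : (S ⊔ T).1 = S.1 ∪ T.1 := rfl

theorem infSup_eq_iff {p p' : DownFinset α × DownFinset α} : infSup p = infSup p' ↔
    p.1.1 ∩ p.2.1 = p'.1.1 ∩ p'.2.1 ∧ p.1.1 ∪ p.2.1 = p'.1.1 ∪ p'.2.1 := by
  simp [infSup, Prod.ext_iff, Subtype.ext_iff, DownFinset.coe_inf, DownFinset.coe_sup]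

theorem symmDiff_eq_of_infSup_eq {p p' : DownFinset α × DownFinset α} (h : infSup p = infSup p') :
    p.1.1 ∆ p.2.1 = p'.1.1 ∆ p'.2.1 := by
  rw [infSup_eq_iff] at h
  rw [symmDiff_eq_sup_sdiff_inf, symmDiff_eq_sup_sdiff_inf]
  simp [h.1, h.2]

theorem card_add_card_eq_of_infSup_eq {p p' : DownFinset α × DownFinset α}
    (h : infSup p = infSup p') : #p.1.1 + #p.2.1 = #p'.1.1 + #p'.2.1 := by
  rw [infSup_eq_iff] at h
  rw [← card_inter_add_card_union p.1.1, h.1, h.2, card_inter_add_card_union]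

theorem eq_of_le_of_infSup_eq {p p' : DownFinset α × DownFinset α}
    (h : infSup p = infSup p') (h₁ : p'.1 ≤ p.1) (h₂ : p'.2 ≤ p.2) : p = p' := by
  rw [infSup_eq_iff] at h
  simp only [Finset.ext_iff, mem_inter, mem_union] at h
  refine Prod.ext (le_antisymm (fun x hx => ?_) h₁) (le_antisymm (fun x hx => ?_) h₂)
  all_goals
    have h₁' := @h₁ x
    have h₂' := @h₂ x
    have h₃ := h.1 x
    have h₄ := h.2 x
    tauto

variable {σ τ : α → α → Prop}

theorem IsLinExt.dRevLexLT_iff (hσ : IsLinExt σ) {S T : DownFinset α} {m : α}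
    (hm : m ∈ S.1 ∆ T.1) (hmax : ∀ x ∈ S.1 ∆ T.1, σ x m) : DRevLexLT σ S T ↔ m ∈ T.1 := by
  constructor
  · rintro ⟨m', hm', hmax'⟩
    have h' : m' ∈ S.1 ∆ T.1 := by simp [mem_symmDiff] at hm' ⊢; tauto
    rw [hσ.antisymm (hmax' m hm) (hmax m' h')] 
    exact (mem_sdiff.1 hm').1
  · intro h
    refine ⟨m, ?_, hmax⟩
    simp [mem_symmDiff] at hm ⊢; tauto

theorem IsLinExt.exists_max_symmDiff (hσ : IsLinExt σ) {S T : DownFinset α} (h : S ≠ T) :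
    ∃ m ∈ S.1 ∆ T.1, ∀ x ∈ S.1 ∆ T.1, σ x m := by
  refine hσ.exists_max (nonempty_iff_ne_empty.2 fun h0 => h (Subtype.ext ?_))
  exact symmDiff_eq_bot.1 h0

theorem IsLinExt.dRevLex_s16 (hσ : IsLinExt σ) : IsLinExt (DRevLex σ) := by
  have htrans : ∀ S T U : DownFinset α, DRevLexLT σ S T → DRevLexLT σ T U → DRevLexLT σ S U := by
    rintro S T U ⟨a, ha, hamax⟩ ⟨b, hb, hbmax⟩
    simp only [mem_sdiff, mem_symmDiff] at ha hamax hb hbmax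
    rcases hσ.total a b with hab | hba
    · have hbS : b ∉ S.1 := fun h =>
        hb.2 (hσ.antisymm hab (hamax b (Or.inl ⟨h, hb.2⟩)) ▸ ha.1)
      refine ⟨b, by simp [hb.1, hbS], fun x hx => ?_⟩
      simp only [mem_symmDiff] at hx
      by_cases hxT : x ∈ T.1
      · by_cases hxU : x ∈ U.1
        · exact hσ.trans (hamax x (by tauto)) hab
        · exact hbmax x (by tauto)
      · by_cases hxU : x ∈ U.1
        · exact hbmax x (by tauto)
        · exact hσ.trans (hamax x (by tauto)) hab
    · have haU : a ∈ U.1 := by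
        by_contra h
        have := hσ.antisymm hba (hbmax a (Or.inl ⟨ha.1, h⟩))
        subst this
        exact h hb.1
      refine ⟨a, by simp [ha.2, haU], fun x hx => ?_⟩
      simp only [mem_symmDiff] at hx
      by_cases hxT : x ∈ T.1
      · by_cases hxU : x ∈ U.1
        · exact hamax x (by tauto)
        · exact hσ.trans (hbmax x (by tauto)) hba
      · by_cases hxU : x ∈ U.1
        · exact hσ.trans (hbmax x (by tauto)) hba
        · exact hamax x (by tauto)
  have hirrefl : ∀ S : DownFinset α, ¬ DRevLexLT σ S S := by
    rintro S ⟨m, hm, -⟩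
    simp at hm
  refine ⟨{ refl := fun S => Or.inl rfl, trans := ?_, antisymm := ?_, total := ?_ }, ?_⟩
  · rintro S T U (rfl | h) (rfl | h')
    · exact Or.inl rfl
    · exact Or.inr h'
    · exact Or.inr h
    · exact Or.inr (htrans S T U h h')
  · rintro S T (rfl | h) (h' | h')
    · rfl
    · rfl
    · exact h'.symm
    · exact absurd (htrans S T S h h') (hirrefl S)
  · intro S T
    by_cases h : S = T
    · exact Or.inl (Or.inl h)
    obtain ⟨m, hm, hmax⟩ := hσ.exists_max_symmDiff h
    by_cases hmT : m ∈ T.1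
    · exact Or.inl (Or.inr ((hσ.dRevLexLT_iff hm hmax).2 hmT))
    · refine Or.inr (Or.inr ((hσ.dRevLexLT_iff (S := T) (T := S) (m := m) ?_ ?_).2 ?_))
      · rwa [symmDiff_comm]
      · rwa [symmDiff_comm]
      · simp [mem_symmDiff] at hm; tauto
  · intro S T hST
    by_cases h : S = T
    · exact Or.inl h
    obtain ⟨m, hm, hmax⟩ := hσ.exists_max_symmDiff h
    refine Or.inr ((hσ.dRevLexLT_iff hm hmax).2 ?_)
    have hsub : S.1 ⊆ T.1 := hST
    rcases mem_symmDiff.1 hm with h | h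
    · exact hsub h.1
    · exact h.1

/-- In a pair of incomparable downsets, the pair can be changed, keeping meet and join, such that
the two maxima of the symmetric difference are separated. -/
theorem IsRealizer2.exists_separation (h : IsRealizer2 σ τ) {S T : DownFinset α}
    (hST : ¬ S ≤ T) (hTS : ¬ T ≤ S) {a b : α} (ha : a ∈ S.1 ∆ T.1)
    (hamax : ∀ x ∈ S.1 ∆ T.1, σ x a) (hb : b ∈ S.1 ∆ T.1) (hbmax : ∀ x ∈ S.1 ∆ T.1, τ x b) :
    ∃ p : DownFinset α × DownFinset α, infSup p = infSup (S, T) ∧ a ∈ p.2.1 ∧ b ∈ p.1.1 := by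
  wlog haT : a ∈ T.1 generalizing S T with H
  · rw [symmDiff_comm] at ha hamax hb hbmax
    obtain ⟨p, hp, h₁⟩ := H hTS hST ha hamax hb hbmax (by simp [mem_symmDiff] at ha; tauto)
    exact ⟨p, hp.trans (infSup_swap (S, T)), h₁⟩
  by_cases hbS : b ∈ S.1
  · exact ⟨(S, T), rfl, haT, hbS⟩
  obtain ⟨c, hcS, hcT⟩ : ∃ c ∈ S.1, c ∉ T.1 := not_subset.1 hST
  simp only [mem_symmDiff] at *
  have haS : a ∉ S.1 := by tauto
  have hbT : b ∈ T.1 := by tauto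
  have hSmem : ∀ {x y : α}, x ≤ y → y ∈ S.1 → x ∈ S.1 := S.mem_of_le
  have hTmem : ∀ {x y : α}, x ≤ y → y ∈ T.1 → x ∈ T.1 := T.mem_of_le
  have hinc : ∀ x, x ∈ T.1 → x ∉ S.1 → ¬ x ≤ c ∧ ¬ c ≤ x := fun x hx hxS =>
    ⟨fun hxc => hxS (hSmem hxc hcS), fun hcx => hcT (hTmem hcx hx)⟩
  have hcross : ∀ x y, x ∈ T.1 → x ∉ S.1 → y ∈ T.1 → y ∉ S.1 → x ≤ y → (σ c x ↔ σ c y) := by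
    intro x y hx hxS hy hyS hxy
    refine ⟨fun hcx => h.1.trans hcx (h.1.2 x y hxy), fun hcy => ?_⟩
    by_contra hcx
    have h₁ := h.reversed (hinc x hx hxS).1 ((h.1.total x c).resolve_right hcx)
    have h₂ := h.reversed (hinc y hy hyS).2 hcy
    have h₃ := h.2.1.trans (h.2.1.2 x y hxy) h₂
    exact hcT (by rwa [h.2.1.antisymm h₁ h₃])
  have hca : σ c a := hamax c (by tauto)
  have hcb : ¬ σ c b := fun hcb => by
    have h₁ := h.reversed (hinc b hbT hbS).2 hcb
    have h₂ := hbmax c (by tauto)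
    exact hcT (by rwa [h.2.1.antisymm h₂ h₁])
  classical
  refine ⟨(⟨S.1 ∪ T.1.filter (fun x => ¬ σ c x), ?_⟩,
    ⟨T.1.filter (fun x => x ∈ S.1 ∨ σ c x), ?_⟩), ?_, ?_, ?_⟩
  · intro y x hxy hy
    simp only [mem_coe, mem_union, mem_filter] at hy ⊢
    by_cases hxS : x ∈ S.1
    · exact Or.inl hxS
    have hyS : y ∉ S.1 := fun h => hxS (hSmem hxy h)
    have hy' := hy.resolve_left hyS
    have hxT := hTmem hxy hy'.1
    exact Or.inr ⟨hxT, (hcross x y hxT hxS hy'.1 hyS hxy).not.2 hy'.2⟩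
  · intro y x hxy hy
    simp only [mem_coe, mem_filter] at hy ⊢
    have hxT := hTmem hxy hy.1
    refine ⟨hxT, ?_⟩
    by_cases hxS : x ∈ S.1
    · exact Or.inl hxS
    have hyS : y ∉ S.1 := fun h => hxS (hSmem hxy h)
    exact Or.inr ((hcross x y hxT hxS hy.1 hyS hxy).2 (hy.2.resolve_left hyS))
  · rw [infSup_eq_iff]
    constructor <;> ext x <;> simp <;> tauto
  · simp [haT, hca]
  · simp [hbT, hcb]

end Downsets

section Diametral

variable {α : Type*} [PartialOrder α] [DecidableEq α] {σ τ : α → α → Prop}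

/-- Mixing a pair with another pair of the same meet and join. -/
theorem mix_mem_fiber [Fintype α] {p₀ p q : DownFinset α × DownFinset α} (h₀ : p₀ ∈ fiber q)
    (h : p ∈ fiber q) :
    ((p.1 ⊓ p₀.1) ⊔ (p.2 ⊓ p₀.2), (p.1 ⊓ p₀.2) ⊔ (p.2 ⊓ p₀.1)) ∈ fiber q := by
  rw [mem_fiber] at *
  have key := infSup_eq_iff.1 (h.trans h₀.symm)
  simp only [Finset.ext_iff, mem_inter, mem_union] at key
  rw [← h, infSup_eq_iff]
  constructor <;> ext x <;> have h₁ := key.1 x <;> have h₂ := key.2 x <;>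
    simp only [DownFinset.coe_inf, DownFinset.coe_sup, mem_inter, mem_union] <;> tauto

theorem mix_mix [Fintype α] {p₀ p q : DownFinset α × DownFinset α} (h₀ : p₀ ∈ fiber q)
    (h : p ∈ fiber q) :
    (((p.1 ⊓ p₀.1) ⊔ (p.2 ⊓ p₀.2)) ⊓ p₀.1) ⊔ (((p.1 ⊓ p₀.2) ⊔ (p.2 ⊓ p₀.1)) ⊓ p₀.2) = p.1 ∧
    (((p.1 ⊓ p₀.1) ⊔ (p.2 ⊓ p₀.2)) ⊓ p₀.2) ⊔ (((p.1 ⊓ p₀.2) ⊔ (p.2 ⊓ p₀.1)) ⊓ p₀.1) = p.2 := by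
  rw [mem_fiber] at *
  have key := infSup_eq_iff.1 (h.trans h₀.symm)
  simp only [Finset.ext_iff, mem_inter, mem_union] at key
  constructor <;> apply Subtype.ext <;> ext x <;> have h₁ := key.1 x <;> have h₂ := key.2 x <;>
    simp only [DownFinset.coe_inf, DownFinset.coe_sup, mem_inter, mem_union] <;> tauto

theorem mem_symmDiff_of_mem_fiber [Fintype α] {p₀ p q : DownFinset α × DownFinset α}
    (h₀ : p₀ ∈ fiber q) (h : p ∈ fiber q) {x : α} (hx : x ∈ p₀.1.1 ∆ p₀.2.1) :
    (x ∈ p.1.1 ↔ x ∉ p.2.1) := by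
  rw [mem_fiber] at *
  rw [← symmDiff_eq_of_infSup_eq (h.trans h₀.symm), mem_symmDiff] at hx
  tauto

/-- If the two maxima are separated by some pair, this happens for a quarter of all pairs. -/
theorem card_fiber_le_four_mul [Fintype α] {p₀ q : DownFinset α × DownFinset α}
    (h₀ : p₀ ∈ fiber q) {a b : α} (ha : a ∈ p₀.1.1 ∆ p₀.2.1) (hb : b ∈ p₀.1.1 ∆ p₀.2.1)
    (ha₀ : a ∈ p₀.2.1) (hb₀ : b ∈ p₀.1.1) :
    #(fiber q) ≤ 4 * #((fiber q).filter fun p => a ∈ p.2.1 ∧ b ∈ p.1.1) := by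
  have ha₁ : a ∉ p₀.1.1 := fun h => (mem_symmDiff_of_mem_fiber h₀ h₀ ha).1 h ha₀
  have hb₁ : b ∉ p₀.2.1 := (mem_symmDiff_of_mem_fiber h₀ h₀ hb).1 hb₀
  set Q := (fiber q).filter fun p => a ∈ p.2.1 ∧ b ∈ p.1.1 with hQ
  have hmemQ : ∀ p, p ∈ Q ↔ p ∈ fiber q ∧ a ∈ p.2.1 ∧ b ∈ p.1.1 := fun p => by simp [hQ]
  set A := (fiber q).filter fun p => a ∈ p.1.1 ∧ b ∈ p.2.1 with hA
  set B := (fiber q).filter fun p => a ∈ p.1.1 ∧ b ∈ p.1.1 with hB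
  set C := (fiber q).filter fun p => a ∈ p.2.1 ∧ b ∈ p.2.1 with hC
  have hcover : fiber q ⊆ (Q ∪ A) ∪ (B ∪ C) := by
    intro p hp
    have h₁ := mem_symmDiff_of_mem_fiber h₀ hp ha
    have h₂ := mem_symmDiff_of_mem_fiber h₀ hp hb
    simp only [hQ, hA, hB, hC, mem_union, mem_filter, hp, true_and]
    tauto
  have hAQ : #A ≤ #Q := by
    refine card_le_card_of_injOn Prod.swap (fun p hp => ?_) Prod.swap_injective.injOn
    simp only [hA, coe_filter, Set.mem_ofPred_eq] at hp
    exact (hmemQ _).2 ⟨swap_mem_fiber.2 hp.1, hp.2⟩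
  have hCB : #C ≤ #B := by
    refine card_le_card_of_injOn Prod.swap (fun p hp => ?_) Prod.swap_injective.injOn
    simp only [hC, coe_filter, Set.mem_ofPred_eq] at hp
    simp only [hB, coe_filter, Set.mem_ofPred_eq]
    exact ⟨swap_mem_fiber.2 hp.1, hp.2⟩
  have hBQ : #B ≤ #Q := by
    refine card_le_card_of_injOn
      (fun p => ((p.1 ⊓ p₀.1) ⊔ (p.2 ⊓ p₀.2), (p.1 ⊓ p₀.2) ⊔ (p.2 ⊓ p₀.1))) (fun p hp => ?_) ?_
    · simp only [hB, coe_filter, Set.mem_ofPred_eq] at hp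
      refine (hmemQ _).2 ⟨mix_mem_fiber h₀ hp.1, ?_⟩
      simp only [DownFinset.coe_inf, DownFinset.coe_sup, mem_inter, mem_union]
      tauto
    · intro p hp p' hp' heq
      simp only [hB, coe_filter, Set.mem_ofPred_eq] at hp hp'
      simp only [Prod.mk.injEq] at heq
      have h₁ := mix_mix h₀ hp.1
      have h₂ := mix_mix h₀ hp'.1
      rw [heq.1, heq.2] at h₁
      exact Prod.ext (h₁.1.symm.trans h₂.1) (h₁.2.symm.trans h₂.2)
  have h₁ := card_le_card hcover
  have h₂ := card_union_le (Q ∪ A) (B ∪ C)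
  have h₃ := card_union_le Q A
  have h₄ := card_union_le B C
  omega

/-- The revlex reversals of a fiber. -/
theorem mem_reversals_dRevLex [Fintype α] (hσ : IsLinExt σ) (hτ : IsLinExt τ)
    {p₀ p : DownFinset α × DownFinset α} {a b : α} (ha : a ∈ p₀.1.1 ∆ p₀.2.1)
    (hamax : ∀ x ∈ p₀.1.1 ∆ p₀.2.1, σ x a) (hb : b ∈ p₀.1.1 ∆ p₀.2.1)
    (hbmax : ∀ x ∈ p₀.1.1 ∆ p₀.2.1, τ x b) :
    p ∈ reversals (DRevLex σ) (DRevLex τ) (infSup p₀) ↔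
      p ∈ fiber (infSup p₀) ∧ a ∈ p.2.1 ∧ b ∈ p.1.1 := by
  rw [mem_reversals, mem_fiber]
  refine and_congr_right fun h => ?_
  have hD := symmDiff_eq_of_infSup_eq h
  have hne : p.1 ≠ p.2 := fun h => by
    rw [← hD, h] at ha
    simp at ha
  rw [← hD] at ha hamax hb hbmax
  rw [symmDiff_comm] at hb hbmax
  simp only [DRevLex, hne, hne.symm, false_or, ne_eq, not_false_eq_true, true_and,
    hσ.dRevLexLT_iff ha hamax, hτ.dRevLexLT_iff hb hbmax]

/-- The revlex pair of a realizer has the most reversals in each fiber. -/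
theorem IsRealizer2.card_reversals_le [Fintype α] (h : IsRealizer2 σ τ)
    {L₁ L₂ : DownFinset α → DownFinset α → Prop} (h₁ : IsLinExt L₁) (h₂ : IsLinExt L₂)
    (q : DownFinset α × DownFinset α) :
    #(reversals L₁ L₂ q) ≤ #(reversals (DRevLex σ) (DRevLex τ) q) := by
  rcases (reversals L₁ L₂ q).eq_empty_or_nonempty with h0 | ⟨p, hp⟩
  · simp [h0]
  rw [mem_reversals] at hp
  obtain ⟨rfl, hne, hp₁, hp₂⟩ := hp
  obtain ⟨a, ha, hamax⟩ := h.1.exists_max_symmDiff hne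
  obtain ⟨b, hb, hbmax⟩ := h.2.1.exists_max_symmDiff hne
  obtain ⟨hle, hge⟩ := not_le_of_reversed h₁ h₂ hne hp₁ hp₂
  obtain ⟨p₀, hp₀, ha₀, hb₀⟩ := h.exists_separation hle hge ha hamax hb hbmax
  have hupper := four_mul_card_reversals_le h₁ h₂ (infSup p)
  have hlower := card_fiber_le_four_mul (q := infSup p) (mem_fiber.2 hp₀)
    (by rwa [symmDiff_eq_of_infSup_eq hp₀]) (by rwa [symmDiff_eq_of_infSup_eq hp₀]) ha₀ hb₀
  have hQ : ((fiber (infSup p)).filter fun p => a ∈ p.2.1 ∧ b ∈ p.1.1) =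
      reversals (DRevLex σ) (DRevLex τ) (infSup p) := by
    ext p'
    rw [mem_reversals_dRevLex h.1 h.2.1 ha hamax hb hbmax, mem_filter]
  rw [hQ] at hlower
  omega

/-- A diametral pair has as many reversals in each fiber as the revlex pair of a realizer. -/
theorem IsRealizer2.card_reversals_eq [Fintype α] (h : IsRealizer2 σ τ)
    {L Lbar : DownFinset α → DownFinset α → Prop} (hL : IsLinExt L) (hLbar : IsLinExt Lbar)
    (hdiam : ∀ M₁ M₂ : DownFinset α → DownFinset α → Prop,
      IsLinExt M₁ → IsLinExt M₂ → revCount M₁ M₂ ≤ revCount L Lbar)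
    (q : DownFinset α × DownFinset α) :
    #(reversals L Lbar q) = #(reversals (DRevLex σ) (DRevLex τ) q) := by
  have hle := hdiam _ _ h.1.dRevLex_s16 h.2.1.dRevLex_s16
  rw [revCount_eq_sum, revCount_eq_sum] at hle
  have hfib : ∀ q ∈ (univ : Finset (DownFinset α × DownFinset α)),
      #(reversals L Lbar q) ≤ #(reversals (DRevLex σ) (DRevLex τ) q) :=
    fun q _ => h.card_reversals_le hL hLbar q
  exact (sum_eq_sum_iff_of_le hfib).1 (le_antisymm (sum_le_sum hfib) hle) q (mem_univ q)

theorem IsRealizer2.exists_mem_reversals [Fintype α] (h : IsRealizer2 σ τ) {S T : DownFinset α}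
    (hST : ¬ S ≤ T) (hTS : ¬ T ≤ S) :
    (reversals (DRevLex σ) (DRevLex τ) (infSup (S, T))).Nonempty := by
  have hne : S ≠ T := fun h => hST h.le
  obtain ⟨a, ha, hamax⟩ := h.1.exists_max_symmDiff hne
  obtain ⟨b, hb, hbmax⟩ := h.2.1.exists_max_symmDiff hne
  obtain ⟨p, hp, hpab⟩ := h.exists_separation hST hTS ha hamax hb hbmax
  exact ⟨p, (mem_reversals_dRevLex h.1 h.2.1 (p₀ := (S, T)) ha hamax hb hbmax).2
    ⟨mem_fiber.2 hp, hpab⟩⟩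

end Diametral

section Uniqueness

variable {α : Type*} [PartialOrder α] [DecidableEq α] {σ τ : α → α → Prop}
  {L Lbar : DownFinset α → DownFinset α → Prop}

theorem isLowerSet_erase {T : DownFinset α} {x : α} (hx : Maximal (· ∈ T.1) x) :
    IsLowerSet (↑(T.1.erase x) : Set α) := by
  intro y z hzy hy
  simp only [coe_erase, Set.mem_sdiff, mem_coe, Set.mem_singleton_iff] at hy ⊢
  refine ⟨T.mem_of_le hzy hy.1, ?_⟩
  rintro rfl
  exact hy.2 (le_antisymm (hx.2 hy.1 hzy) hzy)

/-- If the larger downset has a maximal element other than the maximum of the symmetric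
difference, then the pair is sorted correctly in one of the two orders. -/
theorem IsRealizer2.sorted_of_maximal_ne (h : IsRealizer2 σ τ) (hL : IsLinExt L)
    (hLbar : IsLinExt Lbar) {S T : DownFinset α} {a b x : α} (ha : a ∈ T.1 \ S.1)
    (hamax : ∀ y ∈ S.1 ∆ T.1, σ y a) (hb : b ∈ S.1 \ T.1) (hbmax : ∀ y ∈ S.1 ∆ T.1, τ y b)
    (ihL : ∀ S' T' : DownFinset α, #S'.1 + #T'.1 < #S.1 + #T.1 → DRevLexLT σ S' T' → L S' T')
    (ihLbar : ∀ S' T' : DownFinset α,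
      #S'.1 + #T'.1 < #S.1 + #T.1 → DRevLexLT τ S' T' → Lbar S' T')
    (hx : Maximal (· ∈ T.1) x) (hxa : x ≠ a) : L S T ∨ Lbar T S := by
  simp only [mem_sdiff, mem_symmDiff] at ha hamax hb hbmax
  by_cases hσ : σ x a
  · let T' : DownFinset α := ⟨T.1.erase x, isLowerSet_erase hx⟩
    have hT' : #T'.1 < #T.1 := card_erase_lt_of_mem hx.1
    refine Or.inl (hL.trans (ihL S T' (by omega) ⟨a, ?_, fun y hy => ?_⟩)
      (hL.2 T' T (erase_subset x T.1)))
    · simp only [T', mem_sdiff, mem_erase]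
      exact ⟨⟨hxa.symm, ha.1⟩, ha.2⟩
    · simp only [T', mem_symmDiff, mem_erase] at hy
      by_cases hyx : y = x
      · rwa [hyx]
      · exact hamax y (by tauto)
  · have hxS : x ∈ S.1 := by
      by_contra hxS
      exact hσ (hamax x (Or.inr ⟨hx.1, hxS⟩))
    have hxmax : Maximal (· ∈ S.1) x := by
      refine ⟨hxS, fun y hy hxy => ?_⟩
      by_cases hyT : y ∈ T.1
      · exact hx.2 hyT hxy
      · exact absurd (h.1.trans (h.1.2 x y hxy) (hamax y (Or.inl ⟨hy, hyT⟩))) hσ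
    let S' : DownFinset α := ⟨S.1.erase x, isLowerSet_erase hxmax⟩
    have hS' : #S'.1 < #S.1 := card_erase_lt_of_mem hxS
    have hxτ : τ x b := h.2.1.trans
      (h.reversed (fun hax => ha.2 (S.mem_of_le hax hxS)) ((h.1.total x a).resolve_left hσ))
      (hbmax a (Or.inr ha))
    refine Or.inr (hLbar.trans (ihLbar T S' (by omega) ⟨b, ?_, fun y hy => ?_⟩)
      (hLbar.2 S' S (erase_subset x S.1)))
    · simp only [S', mem_sdiff, mem_erase]
      refine ⟨⟨?_, hb.1⟩, hb.2⟩
      rintro rfl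
      exact hb.2 hx.1
    · simp only [S', mem_symmDiff, mem_erase] at hy
      by_cases hyx : y = x
      · rwa [hyx]
      · exact hbmax y (by tauto)

/-- A pair whose larger member also contains the maximum for the other order can be sorted by
shrinking the larger member. -/
theorem sorted_of_shrink (hL : IsLinExt L) {p p₀ : DownFinset α × DownFinset α}
    (hp : infSup p = infSup p₀) {a b : α} (hamax : ∀ y ∈ p₀.1.1 ∆ p₀.2.1, σ y a)
    (ha : a ∈ p.2.1) (hb : b ∈ p.2.1) (ha₀ : a ∈ p₀.2.1) (ha₀' : a ∉ p₀.1.1) (hb₀ : b ∉ p₀.2.1)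
    (ihL : ∀ S' T' : DownFinset α,
      #S'.1 + #T'.1 < #p₀.1.1 + #p₀.2.1 → DRevLexLT σ S' T' → L S' T') : L p.1 p.2 := by
  have hcard : #p.1.1 + #p.2.1 = #p₀.1.1 + #p₀.2.1 :=
    card_add_card_eq_of_infSup_eq hp
  have hlt : #(p.2 ⊓ p₀.2).1 < #p.2.1 := card_lt_card
    ⟨inter_subset_left, fun hsub => hb₀ (mem_inter.1 (hsub hb)).2⟩
  have ha' : a ∉ p.1.1 := by
    have key := (infSup_eq_iff.1 hp).1
    simp only [Finset.ext_iff, mem_inter] at key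
    have := key a
    tauto
  rw [← symmDiff_eq_of_infSup_eq hp] at hamax
  refine hL.trans (ihL p.1 (p.2 ⊓ p₀.2) (by omega) ⟨a, ?_, fun y hy => hamax y ?_⟩)
    (hL.2 _ _ inf_le_left)
  · rw [mem_sdiff, DownFinset.coe_inf, mem_inter]
    exact ⟨⟨ha, ha₀⟩, ha'⟩
  · have key := (infSup_eq_iff.1 hp).1
    simp only [Finset.ext_iff, mem_inter] at key
    have := key y
    simp only [mem_symmDiff, DownFinset.coe_inf, mem_inter] at hy ⊢
    tauto

theorem eq_dRevLex (hσ : IsLinExt σ) (hL : IsLinExt L)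
    (h : ∀ S T : DownFinset α, DRevLexLT σ S T → L S T) : L = DRevLex σ := by
  have hle : ∀ S T, DRevLex σ S T → L S T := by
    rintro S T (rfl | h')
    · exact hL.refl S
    · exact h S T h'
  funext S T
  refine propext ⟨fun h' => ?_, hle S T⟩
  rcases hσ.dRevLex_s16.total S T with h'' | h''
  · exact h''
  · exact Or.inl (hL.antisymm h' (hle T S h''))

variable [Fintype α] [DecidableRel ((· ≤ ·) : α → α → Prop)]

theorem mem_pdown {x y : α} : y ∈ (pdown x).1 ↔ y ≤ x := by
  simp [pdown]

theorem pdown_le_iff {x : α} {S : DownFinset α} : pdown x ≤ S ↔ x ∈ S.1 :=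
  ⟨fun h => h (mem_pdown.2 le_rfl), fun h _ hy => S.mem_of_le (mem_pdown.1 hy) h⟩

theorem pdown_le_pdown {x y : α} : pdown x ≤ pdown y ↔ x ≤ y := by
  rw [pdown_le_iff, mem_pdown]

theorem pdown_injective : Function.Injective (pdown : α → DownFinset α) := fun _ _ h =>
  le_antisymm (pdown_le_pdown.1 h.le) (pdown_le_pdown.1 h.ge)

theorem eq_pdown_of_maximal {T : DownFinset α} {a : α} (ha : a ∈ T.1)
    (h : ∀ x, Maximal (· ∈ T.1) x → x = a) : T = pdown a := by
  refine le_antisymm (fun y hy => ?_) (pdown_le_iff.2 ha)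
  obtain ⟨x, hyx, hx⟩ := T.1.exists_le_maximal hy
  rw [h x hx] at hyx
  exact mem_pdown.2 hyx

/-- The order of the principal downsets is a linear extension. -/
theorem IsLinExt.comap_pdown (hL : IsLinExt L) :
    IsLinExt fun x y : α => L (pdown x) (pdown y) where
  left :=
    { refl := fun _ => hL.refl _
      trans := fun _ _ _ => hL.trans
      antisymm := fun _ _ h h' => pdown_injective (hL.antisymm h h')
      total := fun _ _ => hL.total _ _ }
  right := fun _ _ h => hL.2 _ _ (pdown_le_pdown.2 h)

/-- The meet and the join of two incomparable principal downsets determine the pair. -/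
theorem eq_or_eq_swap_of_infSup_pdown {p : DownFinset α × DownFinset α} {x y : α}
    (h : infSup p = infSup (pdown x, pdown y)) (h₁ : ¬ p.1 ≤ p.2) (h₂ : ¬ p.2 ≤ p.1) :
    p = (pdown x, pdown y) ∨ p = (pdown y, pdown x) := by
  have hunion := (infSup_eq_iff.1 h).2
  have hmem : ∀ z, z ≤ x ∨ z ≤ y ↔ z ∈ p.1.1 ∨ z ∈ p.2.1 := fun z => by
    rw [← mem_union, hunion, mem_union, mem_pdown, mem_pdown]
  have hx := (hmem x).1 (Or.inl le_rfl)
  have hy := (hmem y).1 (Or.inr le_rfl)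
  have hsup : ∀ {S : DownFinset α}, x ∈ S.1 → y ∈ S.1 → p.1 ⊔ p.2 ≤ S := fun {S} hxS hyS z hz =>
    ((hmem z).2 (mem_union.1 hz)).elim (S.mem_of_le · hxS) (S.mem_of_le · hyS)
  rcases hx with hx | hx <;> rcases hy with hy | hy
  · exact absurd (le_sup_right.trans (hsup hx hy)) h₂
  · exact Or.inl (eq_of_le_of_infSup_eq h (pdown_le_iff.2 hx) (pdown_le_iff.2 hy))
  · exact Or.inr (eq_of_le_of_infSup_eq (h.trans (infSup_swap (pdown x, pdown y)).symm)
      (pdown_le_iff.2 hy) (pdown_le_iff.2 hx))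
  · exact absurd (le_sup_left.trans (hsup hx hy)) h₁

theorem isRealizer2_pdown (hL : IsLinExt L) (hLbar : IsLinExt Lbar)
    (hrev : ∀ S T : DownFinset α, ¬ S ≤ T → ¬ T ≤ S → (reversals L Lbar (infSup (S, T))).Nonempty) :
    IsRealizer2 (fun x y : α => L (pdown x) (pdown y)) fun x y => Lbar (pdown x) (pdown y) := by
  refine ⟨hL.comap_pdown, hLbar.comap_pdown, fun x y => ⟨fun h =>
    ⟨hL.comap_pdown.2 _ _ h, hLbar.comap_pdown.2 _ _ h⟩, fun ⟨h₁, h₂⟩ => ?_⟩⟩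
  by_contra hxy
  by_cases hyx : y ≤ x
  · exact hxy (hL.comap_pdown.antisymm h₁ (hL.comap_pdown.2 _ _ hyx)).le
  obtain ⟨p, hp⟩ := hrev (pdown x) (pdown y) (by rwa [pdown_le_pdown]) (by rwa [pdown_le_pdown])
  rw [mem_reversals] at hp
  obtain ⟨hp, hne, hp₁, hp₂⟩ := hp
  obtain ⟨hle, hge⟩ := not_le_of_reversed hL hLbar hne hp₁ hp₂
  rcases eq_or_eq_swap_of_infSup_pdown hp hle hge with rfl | rfl
  · exact hne (hLbar.antisymm h₂ hp₂)
  · exact hne (hL.antisymm hp₁ h₁)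

/-- A pair of downsets separating the two maxima is sorted correctly in one of the orders. -/
theorem IsRealizer2.sorted_of_separated (h : IsRealizer2 σ τ) (hL : IsLinExt L)
    (hLbar : IsLinExt Lbar) (hσ : ∀ x y : α, σ x y ↔ L (pdown x) (pdown y))
    {S T : DownFinset α} {a b : α} (ha : a ∈ T.1 \ S.1)
    (hamax : ∀ y ∈ S.1 ∆ T.1, σ y a) (hb : b ∈ S.1 \ T.1) (hbmax : ∀ y ∈ S.1 ∆ T.1, τ y b)
    (ihL : ∀ S' T' : DownFinset α, #S'.1 + #T'.1 < #S.1 + #T.1 → DRevLexLT σ S' T' → L S' T')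
    (ihLbar : ∀ S' T' : DownFinset α,
      #S'.1 + #T'.1 < #S.1 + #T.1 → DRevLexLT τ S' T' → Lbar S' T') :
    L S T ∨ Lbar T S := by
  by_cases hT : ∀ x, Maximal (· ∈ T.1) x → x = a
  · by_cases hS : ∀ x, Maximal (· ∈ S.1) x → x = b
    · left
      rw [eq_pdown_of_maximal (mem_sdiff.1 ha).1 hT, eq_pdown_of_maximal (mem_sdiff.1 hb).1 hS,
        ← hσ]
      exact hamax b (mem_symmDiff.2 (Or.inl (mem_sdiff.1 hb)))
    · push Not at hS
      obtain ⟨x, hx, hxb⟩ := hS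
      rw [symmDiff_comm] at hamax hbmax
      rw [add_comm] at ihL ihLbar
      exact (h.symm.sorted_of_maximal_ne hLbar hL hb hbmax ha hamax ihLbar ihL hx hxb).symm
  · push Not at hT
    obtain ⟨x, hx, hxa⟩ := hT
    exact h.sorted_of_maximal_ne hL hLbar ha hamax hb hbmax ihL ihLbar hx hxa

/-- Both orders of a pair with as many reversals as the revlex pair are revlex orders. -/
theorem IsRealizer2.le_of_dRevLexLT (h : IsRealizer2 σ τ) (hL : IsLinExt L)
    (hLbar : IsLinExt Lbar) (hσ : ∀ x y : α, σ x y ↔ L (pdown x) (pdown y))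
    (hcard : ∀ q, #(reversals L Lbar q) = #(reversals (DRevLex σ) (DRevLex τ) q)) (n : ℕ) :
    ∀ S T : DownFinset α, #S.1 + #T.1 = n →
      (DRevLexLT σ S T → L S T) ∧ (DRevLexLT τ S T → Lbar S T) := by
  induction n using Nat.strong_induction_on with
  | _ n ih =>
  rintro S T rfl
  have ihL : ∀ S' T' : DownFinset α,
      #S'.1 + #T'.1 < #S.1 + #T.1 → DRevLexLT σ S' T' → L S' T' :=
    fun S' T' hlt => (ih _ hlt S' T' rfl).1
  have ihLbar : ∀ S' T' : DownFinset α,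
      #S'.1 + #T'.1 < #S.1 + #T.1 → DRevLexLT τ S' T' → Lbar S' T' :=
    fun S' T' hlt => (ih _ hlt S' T' rfl).2
  clear ih
  by_cases hST : S ≤ T
  · exact ⟨fun _ => hL.2 _ _ hST, fun _ => hLbar.2 _ _ hST⟩
  by_cases hTS : T ≤ S
  · have hnot : ∀ ρ : α → α → Prop, ¬ DRevLexLT ρ S T := by
      rintro ρ ⟨m, hm, -⟩
      exact (mem_sdiff.1 hm).2 (hTS (mem_sdiff.1 hm).1)
    exact ⟨fun h' => absurd h' (hnot σ), fun h' => absurd h' (hnot τ)⟩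
  have hne : S ≠ T := fun h => hST h.le
  obtain ⟨a, ha, hamax⟩ := h.1.exists_max_symmDiff hne
  obtain ⟨b, hb, hbmax⟩ := h.2.1.exists_max_symmDiff hne
  rw [h.1.dRevLexLT_iff ha hamax, h.2.1.dRevLexLT_iff hb hbmax]
  obtain ⟨p₀, hp₀, ha₀, hb₀⟩ := h.exists_separation hST hTS ha hamax hb hbmax
  have hmem : ∀ {p : DownFinset α × DownFinset α}, infSup p = infSup (S, T) →
      ∀ {x}, x ∈ S.1 ∆ T.1 → (x ∈ p.1.1 ↔ x ∉ p.2.1) := fun hp _ hx =>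
    mem_symmDiff_of_mem_fiber (p₀ := (S, T)) (mem_fiber.2 rfl) (mem_fiber.2 hp) hx
  have ha₀' : a ∉ p₀.1.1 := fun h => (hmem hp₀ ha).1 h ha₀
  have hb₀' : b ∉ p₀.2.1 := (hmem hp₀ hb).1 hb₀
  have hcard₀ : #p₀.1.1 + #p₀.2.1 = #S.1 + #T.1 :=
    card_add_card_eq_of_infSup_eq hp₀
  have hD₀ : p₀.1.1 ∆ p₀.2.1 = S.1 ∆ T.1 := symmDiff_eq_of_infSup_eq hp₀
  have hshrinkL : ∀ p : DownFinset α × DownFinset α, infSup p = infSup (S, T) →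
      a ∈ p.2.1 → b ∈ p.2.1 → L p.1 p.2 := fun p hp hap hbp =>
    sorted_of_shrink hL (hp.trans hp₀.symm) (by rwa [hD₀]) hap hbp ha₀ ha₀' hb₀'
      (by rwa [hcard₀])
  have hshrinkLbar : ∀ p : DownFinset α × DownFinset α, infSup p = infSup (S, T) →
      a ∈ p.2.1 → b ∈ p.2.1 → Lbar p.1 p.2 := fun p hp hap hbp =>
    sorted_of_shrink (p₀ := p₀.swap) hLbar
      ((hp.trans hp₀.symm).trans (infSup_swap p₀).symm)
      (by rw [Prod.fst_swap, Prod.snd_swap, symmDiff_comm, hD₀]; exact hbmax)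
      hbp hap hb₀ hb₀' ha₀' (by rw [Prod.fst_swap, Prod.snd_swap, add_comm, hcard₀]; exact ihLbar)
  have hsub : reversals L Lbar (infSup (S, T)) ⊆
      reversals (DRevLex σ) (DRevLex τ) (infSup (S, T)) := by
    intro p hp
    rw [mem_reversals_dRevLex (p₀ := (S, T)) h.1 h.2.1 ha hamax hb hbmax, mem_fiber]
    rw [mem_reversals] at hp
    obtain ⟨hp, hpne, hpL, hpLbar⟩ := hp
    refine ⟨hp, ?_⟩
    have hpa := hmem hp ha
    have hpb := hmem hp hb
    have hswap := (infSup_swap p).trans hp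
    have hDp : p.1.1 ∆ p.2.1 = S.1 ∆ T.1 := symmDiff_eq_of_infSup_eq hp
    by_cases hap : a ∈ p.2.1 <;> by_cases hbp : b ∈ p.2.1
    · exact absurd (hLbar.antisymm (hshrinkLbar p hp hap hbp) hpLbar) hpne
    · exact ⟨hap, hpb.2 hbp⟩
    · have hcardp : #p.2.1 + #p.1.1 = #S.1 + #T.1 :=
        card_add_card_eq_of_infSup_eq hswap
      rcases h.sorted_of_separated (S := p.2) (T := p.1) hL hLbar hσ
        (mem_sdiff.2 ⟨hpa.2 hap, hap⟩) (by rwa [symmDiff_comm, hDp])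
        (mem_sdiff.2 ⟨hbp, fun hb => hpb.1 hb hbp⟩) (by rwa [symmDiff_comm, hDp])
        (by rwa [hcardp]) (by rwa [hcardp]) with h' | h'
      · exact absurd (hL.antisymm hpL h') hpne
      · exact absurd (hLbar.antisymm h' hpLbar) hpne
    · exact absurd (hL.antisymm hpL (hshrinkL p.swap hswap (hpa.2 hap) (hpb.2 hbp))) hpne
  have heq := eq_of_subset_of_card_le hsub (hcard _).ge
  have hsep : ∀ p : DownFinset α × DownFinset α, infSup p = infSup (S, T) → a ∈ p.2.1 →
      b ∈ p.1.1 → L p.1 p.2 ∧ Lbar p.2 p.1 := fun p hp hap hbp => by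
    have hmem' := (mem_reversals_dRevLex (p₀ := (S, T)) h.1 h.2.1 ha hamax hb hbmax).2
      ⟨mem_fiber.2 hp, hap, hbp⟩
    rw [← heq, mem_reversals] at hmem'
    exact hmem'.2.2
  have hSTa := hmem (p := (S, T)) rfl ha
  have hSTb := hmem (p := (S, T)) rfl hb
  constructor
  · intro haT
    by_cases hbT : b ∈ T.1
    · exact hshrinkL (S, T) rfl haT hbT
    · exact (hsep (S, T) rfl haT (hSTb.2 hbT)).1
  · intro hbT
    by_cases haT : a ∈ T.1
    · exact hshrinkLbar (S, T) rfl haT hbT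
    · exact (hsep (T, S) (infSup_swap (S, T)) (hSTa.2 haT) hbT).2

end Uniqueness

/-- For a finite 2-dimensional poset `P`, every diametral pair `(L, L̄)` of linear
extensions of `D_P` arises from a realizer `{σ, σ̄}` of `P` with `L = L_σ` and `L̄ = L_σ̄`, where
σ is determined by the order of the principal downsets in `L`. -/
theorem diametral_pairs_downset_unique {α : Type*} [Fintype α] [PartialOrder α] [DecidableEq α]
    [DecidableRel ((· ≤ ·) : α → α → Prop)]
    (h2dim : ∃ τ τ' : α → α → Prop, IsRealizer2 τ τ')
    (L Lbar : DownFinset α → DownFinset α → Prop)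
    (hL : IsLinExt L) (hLbar : IsLinExt Lbar)
    (hdiam : ∀ M₁ M₂ : DownFinset α → DownFinset α → Prop,
      IsLinExt M₁ → IsLinExt M₂ → revCount M₁ M₂ ≤ revCount L Lbar)
    (σ : α → α → Prop) (hσ : ∀ x y : α, σ x y ↔ L (pdown x) (pdown y)) :
    ∃ σbar : α → α → Prop, IsRealizer2 σ σbar ∧ L = DRevLex σ ∧ Lbar = DRevLex σbar := by
  obtain ⟨τ, τ', hτ⟩ := h2dim
  obtain rfl : σ = fun x y => L (pdown x) (pdown y) := by
    funext x y
    exact propext (hσ x y)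
  have hreal := isRealizer2_pdown hL hLbar fun S T hST hTS => by
    rw [← card_pos, hτ.card_reversals_eq hL hLbar hdiam, card_pos]
    exact hτ.exists_mem_reversals hST hTS
  have hmain := hreal.le_of_dRevLexLT hL hLbar hσ (hreal.card_reversals_eq hL hLbar hdiam)
  exact ⟨_, hreal, eq_dRevLex hreal.1 hL fun S T => (hmain _ S T rfl).1,
    eq_dRevLex hreal.2.1 hLbar fun S T => (hmain _ S T rfl).2⟩
end

section
/- Let P be the disjoint union of chains C₁, …, C_w with |C_i| = ℓ_i (no relations between different chains). Then 4·led(D_P) = (∏_{i=1}^{w} (ℓ_i + 1))² − ∑_{k=1}^{w} (ℓ_k + 1)·ℓ_k·∏_{i ≠ k} (ℓ_i + 1) − ∏_{i=1}^{w} (ℓ_i + 1). -/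
open Finset
open scoped symmDiff

section Box

variable {ι : Type*} {β : ι → Type*}

/-- Two vectors differing in at most one coordinate are comparable. -/
theorem le_total_of_hammingDist_le_one [Fintype ι] [∀ i, LinearOrder (β i)]
    {x y : ∀ i, β i} (h : hammingDist x y ≤ 1) :
    x ≤ y ∨ y ≤ x := by
  rw [hammingDist, Finset.card_le_one] at h
  by_contra! hxy
  simp only [Pi.le_def, not_forall, not_le] at hxy
  obtain ⟨⟨i, hi⟩, j, hj⟩ := hxy
  have := h i (by simp [hi.ne']) j (by simp [hj.ne])
  subst this
  exact lt_asymm hi hj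

variable [DecidableEq ι]

/-- Exchange the coordinates in `A` between the two members of a pair of vectors. -/
def swapOn (A : Finset ι) (p : (∀ i, β i) × (∀ i, β i)) : (∀ i, β i) × (∀ i, β i) :=
  (A.piecewise p.2 p.1, A.piecewise p.1 p.2)

theorem swapOn_swapOn (A B : Finset ι) (p : (∀ i, β i) × (∀ i, β i)) :
    swapOn A (swapOn B p) = swapOn (A ∆ B) p := by
  ext i <;> by_cases hA : i ∈ A <;> by_cases hB : i ∈ B <;>
    simp [swapOn, Finset.piecewise, Finset.mem_symmDiff, hA, hB]

theorem swapOn_involutive (A : Finset ι) :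
    Function.Involutive (swapOn A : (∀ i, β i) × (∀ i, β i) → _) := fun p => by
  ext i <;> by_cases hA : i ∈ A <;> simp [swapOn, Finset.piecewise, hA]

theorem swapOn_compl [Fintype ι] (A : Finset ι) (p : (∀ i, β i) × (∀ i, β i)) :
    swapOn Aᶜ p = (swapOn A p).swap := by
  ext i <;> by_cases hA : i ∈ A <;> simp [swapOn, Finset.piecewise, hA]

theorem swapOn_apply_eq_iff (A : Finset ι) (p : (∀ i, β i) × (∀ i, β i)) (i : ι) :
    (swapOn A p).1 i = (swapOn A p).2 i ↔ p.1 i = p.2 i := by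
  by_cases hA : i ∈ A <;> simp [swapOn, Finset.piecewise, hA, eq_comm]

variable [∀ i, LinearOrder (β i)]

theorem swapOn_fst_mono {m M : ∀ i, β i} (h : m ≤ M) {A B : Finset ι} (hAB : A ⊆ B) :
    (swapOn A (m, M)).1 ≤ (swapOn B (m, M)).1 := by
  intro i
  have := h i
  by_cases hA : i ∈ A
  · simp [swapOn, Finset.piecewise, hA, hAB hA]
  · by_cases hB : i ∈ B <;> simp [swapOn, Finset.piecewise, hA, hB, this]

theorem swapOn_snd_anti {m M : ∀ i, β i} (h : m ≤ M) {A B : Finset ι} (hAB : A ⊆ B) :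
    (swapOn B (m, M)).2 ≤ (swapOn A (m, M)).2 := by
  intro i
  have := h i
  by_cases hA : i ∈ A
  · simp [swapOn, Finset.piecewise, hA, hAB hA]
  · by_cases hB : i ∈ B <;> simp [swapOn, Finset.piecewise, hA, hB, this]

variable [Fintype ι]

theorem hammingDist_swapOn (A : Finset ι) (p : (∀ i, β i) × (∀ i, β i)) :
    hammingDist (swapOn A p).1 (swapOn A p).2 = hammingDist p.1 p.2 := by
  simp [hammingDist, swapOn_apply_eq_iff]

theorem eq_swapOn_inf_sup (p : (∀ i, β i) × (∀ i, β i)) :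
    p = swapOn {i | p.2 i < p.1 i} (p.1 ⊓ p.2, p.1 ⊔ p.2) := by
  ext i <;> rcases lt_or_ge (p.2 i) (p.1 i) with h | h <;>
    simp [swapOn, Finset.piecewise, h, le_of_lt, not_lt_of_ge]

open Classical in
/-- The swap sets placing the first vector below the second form a lower set. -/
theorem isLowerSet_swapOn_filter {L : (∀ i, β i) → (∀ i, β i) → Prop} (hL : IsLinExt L)
    {m M : ∀ i, β i} (h : m ≤ M) :
    IsLowerSet (({A | L (swapOn A (m, M)).1 (swapOn A (m, M)).2} : Finset (Finset ι)) :
      Set (Finset ι)) := by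
  intro A B hBA hA
  have := hL.1
  simp only [Finset.coe_filter, Finset.mem_univ, true_and, Set.mem_ofPred_eq] at hA ⊢
  exact _root_.trans (hL.2 _ _ (swapOn_fst_mono h hBA))
    (_root_.trans hA (hL.2 _ _ (swapOn_snd_anti h hBA)))

open Classical in
/-- Exactly half of the swaps of a pair of distinct vectors place the first below the second. -/
theorem two_mul_card_swapOn_filter {L : (∀ i, β i) → (∀ i, β i) → Prop} (hL : IsLinExt L)
    {p : (∀ i, β i) × (∀ i, β i)} (hp : p.1 ≠ p.2) :
    2 * #{A : Finset ι | L (swapOn A p).1 (swapOn A p).2} = 2 ^ Fintype.card ι := by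
  have := hL.1
  have hcompl : #{A : Finset ι | L (swapOn A p).1 (swapOn A p).2} =
      #{A : Finset ι | ¬ L (swapOn A p).1 (swapOn A p).2} := by
    refine Finset.card_bij' (fun A _ => Aᶜ) (fun A _ => Aᶜ) ?_ ?_ (by simp) (by simp)
    · intro A hA
      simp only [Finset.mem_filter, Finset.mem_univ, true_and, swapOn_compl, Prod.fst_swap,
        Prod.snd_swap] at hA ⊢
      intro h
      have := antisymm hA h
      exact hp (funext fun i => (swapOn_apply_eq_iff A p i).1 (congrFun this i))
    · intro A hA
      simp only [Finset.mem_filter, Finset.mem_univ, true_and, swapOn_compl, Prod.fst_swap,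
        Prod.snd_swap] at hA ⊢
      exact (total_of L _ _).resolve_left hA
  have := Finset.card_filter_add_card_filter_not (s := (Finset.univ : Finset (Finset ι)))
    (fun A => L (swapOn A p).1 (swapOn A p).2)
  rw [Finset.card_univ, Fintype.card_finset] at this
  omega

open Classical in
theorem four_mul_card_swapOn_reversed_inf_sup_le {L₁ L₂ : (∀ i, β i) → (∀ i, β i) → Prop}
    (h₁ : IsLinExt L₁) (h₂ : IsLinExt L₂) {m M : ∀ i, β i} (h : m ≤ M) (hne : m ≠ M) :
    4 * #{A : Finset ι | L₁ (swapOn A (m, M)).1 (swapOn A (m, M)).2 ∧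
      ¬ L₂ (swapOn A (m, M)).1 (swapOn A (m, M)).2} ≤ 2 ^ Fintype.card ι := by
  have c₁ := two_mul_card_swapOn_filter h₁ (p := (m, M)) hne
  have c₂ := two_mul_card_swapOn_filter h₂ (p := (m, M)) hne
  have hk := (isLowerSet_swapOn_filter h₁ h).le_card_inter_finset (isLowerSet_swapOn_filter h₂ h)
  have hs := Finset.card_sdiff_add_card_inter
    ({A | L₁ (swapOn A (m, M)).1 (swapOn A (m, M)).2} : Finset (Finset ι))
    ({A | L₂ (swapOn A (m, M)).1 (swapOn A (m, M)).2} : Finset (Finset ι))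
  rw [← Finset.filter_and_not] at hs
  set a := #{A : Finset ι | L₁ (swapOn A (m, M)).1 (swapOn A (m, M)).2}
  set b := #{A : Finset ι | L₂ (swapOn A (m, M)).1 (swapOn A (m, M)).2}
  have hpos : 0 < 2 ^ Fintype.card ι := by positivity
  have hab : a = b := by omega
  nlinarith

open Classical in
/-- Among the swaps of a fixed pair of distinct vectors, at most a quarter are reversed. -/
theorem four_mul_card_swapOn_reversed_le {L₁ L₂ : (∀ i, β i) → (∀ i, β i) → Prop}
    (h₁ : IsLinExt L₁) (h₂ : IsLinExt L₂) {p : (∀ i, β i) × (∀ i, β i)} (hp : p.1 ≠ p.2) :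
    4 * #{A : Finset ι | L₁ (swapOn A p).1 (swapOn A p).2 ∧
      ¬ L₂ (swapOn A p).1 (swapOn A p).2} ≤ 2 ^ Fintype.card ι := by
  refine le_trans (Nat.mul_le_mul_left 4 ?_) (four_mul_card_swapOn_reversed_inf_sup_le h₁ h₂
    (m := p.1 ⊓ p.2) (M := p.1 ⊔ p.2) inf_le_sup (fun h => hp (inf_eq_sup.1 h)))
  refine Finset.card_le_card_of_injOn (· ∆ ({i | p.2 i < p.1 i} : Finset ι)) ?_
    (fun A _ B _ hAB => symmDiff_left_injective _ hAB)
  intro A hA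
  simp only [Finset.coe_filter, Finset.mem_univ, true_and, Set.mem_ofPred_eq] at hA ⊢
  rwa [← swapOn_swapOn, ← eq_swapOn_inf_sup]

variable [∀ i, Fintype (β i)]

open Classical in
theorem four_mul_card_reversed_le {L₁ L₂ : (∀ i, β i) → (∀ i, β i) → Prop}
    (h₁ : IsLinExt L₁) (h₂ : IsLinExt L₂) :
    4 * #{p : (∀ i, β i) × (∀ i, β i) | L₁ p.1 p.2 ∧ ¬ L₂ p.1 p.2} ≤
      #{p : (∀ i, β i) × (∀ i, β i) | 2 ≤ hammingDist p.1 p.2} := by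
  have := h₁.1
  have := h₂.1
  have hdist (p : (∀ i, β i) × (∀ i, β i)) (hp : L₁ p.1 p.2 ∧ ¬ L₂ p.1 p.2) :
      2 ≤ hammingDist p.1 p.2 := by
    by_contra! h
    rcases le_total_of_hammingDist_le_one (Nat.lt_succ_iff.1 h) with h | h
    · exact hp.2 (h₂.2 _ _ h)
    · have := antisymm hp.1 (h₁.2 _ _ h)
      exact hp.2 (this ▸ refl p.1)
  have hswap (A : Finset ι) :
      #{p : (∀ i, β i) × (∀ i, β i) | L₁ p.1 p.2 ∧ ¬ L₂ p.1 p.2} =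
      #{p : (∀ i, β i) × (∀ i, β i) | L₁ (swapOn A p).1 (swapOn A p).2 ∧
        ¬ L₂ (swapOn A p).1 (swapOn A p).2} := by
    refine Finset.card_bij' (fun p _ => swapOn A p) (fun p _ => swapOn A p) ?_ ?_
      (fun p _ => swapOn_involutive A p) (fun p _ => swapOn_involutive A p)
    · intro p hp
      simpa [swapOn_involutive A p] using hp
    · intro p hp
      simpa using hp
  refine Nat.le_of_mul_le_mul_left (c := 2 ^ Fintype.card ι) ?_ (by positivity)
  calc 2 ^ Fintype.card ι * (4 * #{p : (∀ i, β i) × (∀ i, β i) | L₁ p.1 p.2 ∧ ¬ L₂ p.1 p.2})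
      = 4 * ∑ A : Finset ι,
          #{p : (∀ i, β i) × (∀ i, β i) | L₁ (swapOn A p).1 (swapOn A p).2 ∧
            ¬ L₂ (swapOn A p).1 (swapOn A p).2} := by
        rw [← Finset.sum_congr rfl (fun A _ => hswap A), Finset.sum_const, Finset.card_univ,
          Fintype.card_finset, smul_eq_mul]
        ring
    _ = ∑ p : (∀ i, β i) × (∀ i, β i), 4 * #{A : Finset ι | L₁ (swapOn A p).1 (swapOn A p).2 ∧
          ¬ L₂ (swapOn A p).1 (swapOn A p).2} := by
        simp_rw [Finset.card_filter]
        rw [Finset.sum_comm, Finset.mul_sum]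
    _ ≤ ∑ p : (∀ i, β i) × (∀ i, β i),
          if 2 ≤ hammingDist p.1 p.2 then 2 ^ Fintype.card ι else 0 := by
        refine Finset.sum_le_sum fun p _ => ?_
        split_ifs with h
        · exact four_mul_card_swapOn_reversed_le h₁ h₂ (hammingDist_pos.1 (by omega))
        · rw [Finset.filter_false_of_mem]
          · simp
          · intro A _ hA
            exact h (hammingDist_swapOn A p ▸ hdist _ hA)
    _ = _ := by
        rw [← Finset.sum_filter, Finset.sum_const, smul_eq_mul, mul_comm]

/-- The number of vectors at Hamming distance one from a given vector. -/
theorem card_hammingDist_eq_one (x : ∀ i, β i) :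
    #{y : ∀ i, β i | hammingDist x y = 1} = ∑ k, (Fintype.card (β k) - 1) := by
  have : ∑ k, (Fintype.card (β k) - 1) =
      #((Finset.univ : Finset ι).sigma fun k => (Finset.univ : Finset (β k)).erase (x k)) := by
    simp [Finset.card_sigma]
  rw [this]
  symm
  refine Finset.card_bij (fun a _ => Function.update x a.1 a.2) ?_ ?_ ?_
  · rintro ⟨k, v⟩ h
    simp only [Finset.mem_sigma, Finset.mem_univ, Finset.mem_erase, true_and, and_true] at h
    simp only [Finset.mem_filter, Finset.mem_univ, true_and, hammingDist, Finset.card_eq_one]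
    refine ⟨k, Finset.ext fun i => ?_⟩
    by_cases hi : i = k
    · subst hi
      simp [Ne.symm h]
    · simp [hi]
  · rintro ⟨k, v⟩ hv ⟨l, u⟩ hu h
    simp only [Finset.mem_sigma, Finset.mem_univ, Finset.mem_erase, true_and, and_true] at hv hu
    have hkl : k = l := by
      by_contra hkl
      have := congrFun h k
      simp [hkl] at this
      exact hv this
    subst hkl
    simpa using congrFun h k
  · intro y hy
    simp only [Finset.mem_filter, Finset.mem_univ, true_and, hammingDist,
      Finset.card_eq_one] at hy
    obtain ⟨k, hk⟩ := hy
    simp only [Finset.ext_iff, Finset.mem_filter, Finset.mem_univ, true_and,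
      Finset.mem_singleton] at hk
    refine ⟨⟨k, y k⟩, by simpa [eq_comm] using (hk k).2 rfl, funext fun i => ?_⟩
    by_cases hi : i = k
    · subst hi
      simp
    · simpa [hi] using hk i

theorem card_two_le_hammingDist :
    #{p : (∀ i, β i) × (∀ i, β i) | 2 ≤ hammingDist p.1 p.2} +
      (∏ i, Fintype.card (β i)) * ∑ k, (Fintype.card (β k) - 1) + ∏ i, Fintype.card (β i) =
      (∏ i, Fintype.card (β i)) ^ 2 := by
  have hx (x : ∀ i, β i) : #{y | 2 ≤ hammingDist x y} + ∑ k, (Fintype.card (β k) - 1) + 1 =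
      ∏ i, Fintype.card (β i) := by
    have h0 : #{y | hammingDist x y = 0} = 1 := by simp [Finset.filter_eq]
    have h2 : ({y | 2 ≤ hammingDist x y} : Finset (∀ i, β i)) =
        ({y | ¬ hammingDist x y = 0} : Finset _).filter (fun y => ¬ hammingDist x y = 1) := by
      ext y
      simp only [Finset.mem_filter, Finset.mem_univ, true_and]
      omega
    have h1 : ({y | hammingDist x y = 1} : Finset (∀ i, β i)) =
        ({y | ¬ hammingDist x y = 0} : Finset _).filter (fun y => hammingDist x y = 1) := by
      ext y
      simp only [Finset.mem_filter, Finset.mem_univ, true_and]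
      omega
    rw [← card_hammingDist_eq_one x, ← Fintype.card_pi, ← Finset.card_univ,
      ← Finset.card_filter_add_card_filter_not (s := Finset.univ) (fun y => hammingDist x y = 0),
      h0, ← Finset.card_filter_add_card_filter_not
        (s := ({y | ¬ hammingDist x y = 0} : Finset (∀ i, β i))) (fun y => hammingDist x y = 1),
      ← h1, ← h2]
    ring
  have hp : #{p : (∀ i, β i) × (∀ i, β i) | 2 ≤ hammingDist p.1 p.2} =
      ∑ x : ∀ i, β i, #{y | 2 ≤ hammingDist x y} := by
    simp_rw [Finset.card_filter]
    exact Fintype.sum_prod_type _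
  have := Finset.sum_congr rfl (fun x (_ : x ∈ (Finset.univ : Finset (∀ i, β i))) => hx x)
  simp only [Finset.sum_add_distrib, Finset.sum_const, Finset.card_univ, smul_eq_mul,
    Fintype.card_pi, mul_one] at this
  rw [hp, this, sq]

end Box

section Lex

variable {ι : Type*} [Fintype ι] [LinearOrder ι] {β : ι → Type*} [∀ i, LinearOrder (β i)]

theorem isLinExt_toLex : IsLinExt fun x y : ∀ i, β i => toLex x ≤ toLex y :=
  ⟨toLex.injective.isLinearOrder_onFun (r := (· ≤ ·)), fun _ _ h => Pi.toLex_monotone h⟩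

theorem isLinExt_toColex : IsLinExt fun x y : ∀ i, β i => toColex x ≤ toColex y :=
  have : IsLinearOrder (Colex (∀ i, β i)) (· ≤ ·) :=
    { total := fun x y => by
        have := Pi.trichotomous_lex (β := β) (· > ·) (· < ·) wellFounded_gt
        by_contra! h
        have hxy := this.trichotomous (ofColex x) (ofColex y)
          (fun h' => h.1 (le_of_lt h')) (fun h' => h.2 (le_of_lt h'))
        exact h.1 (le_of_eq hxy) }
  ⟨toColex.injective.isLinearOrder_onFun (r := (· ≤ ·)), fun _ _ h => Pi.toColex_monotone h⟩

/-- The set consisting of the first coordinate where two vectors differ. -/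
def firstDiff (p : (∀ i, β i) × (∀ i, β i)) : Finset ι :=
  {i | p.1 i ≠ p.2 i ∧ ∀ j < i, p.1 j = p.2 j}

theorem firstDiff_swapOn (A : Finset ι) (p : (∀ i, β i) × (∀ i, β i)) :
    firstDiff (swapOn A p) = firstDiff p := by
  simp [firstDiff, swapOn_apply_eq_iff]

theorem firstDiff_eq_singleton {p : (∀ i, β i) × (∀ i, β i)} {a : ι} (ha : p.1 a ≠ p.2 a)
    (hlt : ∀ j < a, p.1 j = p.2 j) : firstDiff p = {a} := by
  ext i
  simp only [firstDiff, Finset.mem_filter, Finset.mem_univ, true_and, Finset.mem_singleton]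
  refine ⟨fun ⟨hi, h⟩ => ?_, fun h => h ▸ ⟨ha, hlt⟩⟩
  rcases lt_trichotomy i a with h' | h' | h'
  · exact absurd (hlt i h') hi
  · exact h'
  · exact absurd (h a h') ha

theorem swapOn_firstDiff_involutive :
    Function.Involutive fun p : (∀ i, β i) × (∀ i, β i) => swapOn (firstDiff p) p := fun p => by
  simp only [firstDiff_swapOn]
  exact swapOn_involutive _ p

variable [∀ i, Fintype (β i)]

open Classical in
theorem card_two_le_hammingDist_le_four_mul :
    #{p : (∀ i, β i) × (∀ i, β i) | 2 ≤ hammingDist p.1 p.2} ≤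
      4 * #{p : (∀ i, β i) × (∀ i, β i) | toLex p.1 ≤ toLex p.2 ∧ ¬ toColex p.1 ≤ toColex p.2} := by
  set R : Finset ((∀ i, β i) × (∀ i, β i)) :=
    {p | toLex p.1 ≤ toLex p.2 ∧ ¬ toColex p.1 ≤ toColex p.2} with hR
  have memR {p : (∀ i, β i) × (∀ i, β i)} {a b : ι} (ha : ∀ j < a, p.1 j = p.2 j)
      (ha' : p.1 a < p.2 a) (hb : ∀ j > b, p.1 j = p.2 j) (hb' : p.2 b < p.1 b) : p ∈ R := by
    simp only [hR, Finset.mem_filter, Finset.mem_univ, true_and]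
    exact ⟨le_of_lt ⟨a, ha, ha'⟩, not_le_of_gt ⟨b, fun j hj => (hb j hj).symm, hb'⟩⟩
  let f : (∀ i, β i) × (∀ i, β i) → (∀ i, β i) × (∀ i, β i) := fun p => swapOn (firstDiff p) p
  have hf : Function.Involutive f := swapOn_firstDiff_involutive
  have hsub : ({p | 2 ≤ hammingDist p.1 p.2} : Finset ((∀ i, β i) × (∀ i, β i))) ⊆
      (R ∪ R.image Prod.swap) ∪ (R.image f ∪ (R.image f).image Prod.swap) := by
    intro p hp
    replace hp := (Finset.mem_filter.1 hp).2
    rw [hammingDist] at hp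
    set D : Finset ι := {i | p.1 i ≠ p.2 i} with hD
    have hDne : D.Nonempty := Finset.card_pos.1 (by omega)
    have memD (i : ι) : i ∈ D ↔ p.1 i ≠ p.2 i := by simp [hD]
    obtain ⟨a, haD, ha⟩ : ∃ a ∈ D, ∀ i ∈ D, a ≤ i :=
      ⟨_, D.min'_mem hDne, fun i hi => D.min'_le i hi⟩
    obtain ⟨b, hbD, hb⟩ : ∃ b ∈ D, ∀ i ∈ D, i ≤ b :=
      ⟨_, D.max'_mem hDne, fun i hi => D.le_max' i hi⟩
    have hab : a ≠ b := by
      rintro rfl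
      have : D.card ≤ 1 := Finset.card_le_one.2 fun i hi j hj =>
        (le_antisymm (hb i hi) (ha i hi)).trans (le_antisymm (ha j hj) (hb j hj))
      omega
    have ha' : ∀ j < a, p.1 j = p.2 j := fun j hj => by
      by_contra h
      exact absurd (ha j ((memD j).2 h)) hj.not_ge
    have hb' : ∀ j > b, p.1 j = p.2 j := fun j hj => by
      by_contra h
      exact absurd (hb j ((memD j).2 h)) (not_le_of_gt hj)
    have hane := (memD a).1 haD
    have hbne := (memD b).1 hbD
    have hfst : f p = swapOn {a} p := by simp only [f, firstDiff_eq_singleton hane ha']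
    have hfst' : f p.swap = swapOn {a} p.swap := by
      simp only [f, firstDiff_eq_singleton (p := p.swap) hane.symm fun j hj => (ha' j hj).symm]
    simp only [Finset.mem_union]
    rcases lt_or_gt_of_ne hane with h₁ | h₁ <;> rcases lt_or_gt_of_ne hbne with h₂ | h₂
    · refine Or.inr (Or.inr (Finset.mem_image.2 ⟨p.swap, Finset.mem_image.2
        ⟨f p.swap, memR (a := a) (b := b) ?_ ?_ ?_ ?_, hf _⟩, p.swap_swap⟩))
      · exact fun j hj => hfst' ▸ (swapOn_apply_eq_iff {a} p.swap j).2 (ha' j hj).symm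
      · simpa [hfst', swapOn, Finset.piecewise] using h₁
      · exact fun j hj => hfst' ▸ (swapOn_apply_eq_iff {a} p.swap j).2 (hb' j hj).symm
      · simpa [hfst', swapOn, Finset.piecewise, hab.symm] using h₂
    · exact Or.inl (Or.inl (memR ha' h₁ hb' h₂))
    · exact Or.inl (Or.inr (Finset.mem_image.2 ⟨p.swap, memR (fun j hj => (ha' j hj).symm) h₁
        (fun j hj => (hb' j hj).symm) h₂, p.swap_swap⟩))
    · refine Or.inr (Or.inl (Finset.mem_image.2 ⟨f p, memR (a := a) (b := b) ?_ ?_ ?_ ?_, hf _⟩))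
      · exact fun j hj => hfst ▸ (swapOn_apply_eq_iff {a} p j).2 (ha' j hj)
      · simpa [hfst, swapOn, Finset.piecewise] using h₁
      · exact fun j hj => hfst ▸ (swapOn_apply_eq_iff {a} p j).2 (hb' j hj)
      · simpa [hfst, swapOn, Finset.piecewise, hab.symm] using h₂
  have h₀ := Finset.card_le_card hsub
  have h₁ := Finset.card_union_le (R ∪ R.image Prod.swap) (R.image f ∪ (R.image f).image Prod.swap)
  have h₂ := Finset.card_union_le R (R.image Prod.swap)
  have h₃ := Finset.card_union_le (R.image f) ((R.image f).image Prod.swap)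
  have h₄ := Finset.card_image_le (s := R) (f := Prod.swap)
  have h₅ := Finset.card_image_le (s := R) (f := f)
  have h₆ := Finset.card_image_le (s := R.image f) (f := Prod.swap)
  omega

end Lex

section Transport

variable {α γ : Type*} [PartialOrder α] [PartialOrder γ]

theorem IsLinExt.comap (e : α ≃o γ) {L : γ → γ → Prop} (hL : IsLinExt L) :
    IsLinExt fun x y => L (e x) (e y) := by
  have := hL.1
  exact ⟨e.injective.isLinearOrder_onFun (r := L), fun _ _ h => hL.2 _ _ (e.monotone h)⟩

theorem revCount_comap (e : α ≃o γ) (L₁ L₂ : γ → γ → Prop) :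
    revCount (fun x y => L₁ (e x) (e y)) (fun x y => L₂ (e x) (e y)) = revCount L₁ L₂ := by
  refine Set.ncard_congr (fun p _ => (e p.1, e p.2)) ?_ ?_ ?_
  · rintro p ⟨h, h'⟩
    exact ⟨e.injective.ne h, h'⟩
  · rintro p q - - h
    simpa [Prod.ext_iff] using h
  · rintro ⟨x, y⟩ ⟨h, h'⟩
    refine ⟨(e.symm x, e.symm y), ⟨e.symm.injective.ne h, by simpa using h'⟩, by simp⟩

open Classical in
theorem revCount_eq_card_s17 [Fintype γ] {L₁ L₂ : γ → γ → Prop} (h₂ : IsLinExt L₂) :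
    revCount L₁ L₂ = #{p : γ × γ | L₁ p.1 p.2 ∧ ¬ L₂ p.1 p.2} := by
  have := h₂.1
  rw [revCount, ← Set.ncard_coe_finset]
  congr 1
  ext ⟨x, y⟩
  simp only [Set.mem_ofPred_eq, Finset.coe_filter, Finset.mem_univ, true_and]
  constructor
  · rintro ⟨hne, h, h'⟩
    exact ⟨h, fun h'' => hne (antisymm h'' h')⟩
  · rintro ⟨h, h'⟩
    exact ⟨fun e => h' (e ▸ refl x), h, (total_of L₂ x y).resolve_left h'⟩

/-- The linear extension diameter of a poset isomorphic to a product of finite chains. -/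
theorem exists_isGreatest_revCount {ι : Type*} [Fintype ι] [LinearOrder ι] {β : ι → Type*}
    [∀ i, LinearOrder (β i)] [∀ i, Fintype (β i)] (e : α ≃o ∀ i, β i) :
    ∃ m : ℕ, IsGreatest {d : ℕ | ∃ L₁ L₂ : α → α → Prop,
        IsLinExt L₁ ∧ IsLinExt L₂ ∧ d = revCount L₁ L₂} m ∧
      4 * m + (∏ i, Fintype.card (β i)) * ∑ k, (Fintype.card (β k) - 1) +
        ∏ i, Fintype.card (β i) = (∏ i, Fintype.card (β i)) ^ 2 := by
  classical
  have hub {L₁ L₂ : α → α → Prop} (h₁ : IsLinExt L₁) (h₂ : IsLinExt L₂) :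
      4 * revCount L₁ L₂ ≤ #{p : (∀ i, β i) × (∀ i, β i) | 2 ≤ hammingDist p.1 p.2} := by
    rw [← revCount_comap e.symm, revCount_eq_card_s17 (h₂.comap e.symm)]
    exact four_mul_card_reversed_le (h₁.comap e.symm) (h₂.comap e.symm)
  have h₁ := (isLinExt_toLex (β := β)).comap e
  have h₂ := (isLinExt_toColex (β := β)).comap e
  have heq := le_antisymm (hub h₁ h₂) (by
    rw [revCount_comap e (fun x y => toLex x ≤ toLex y) (fun x y => toColex x ≤ toColex y),
      revCount_eq_card_s17 isLinExt_toColex]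
    refine (card_two_le_hammingDist_le_four_mul (β := β)).trans_eq ?_
    congr!)
  refine ⟨_, ⟨⟨_, _, h₁, h₂, rfl⟩, ?_⟩, by rw [heq, card_two_le_hammingDist]⟩
  rintro _ ⟨L₁, L₂, g₁, g₂, rfl⟩
  exact Nat.le_of_mul_le_mul_left ((hub g₁ g₂).trans_eq heq.symm) four_pos

end Transport

section Chains

variable {α : Type*} [PartialOrder α]

theorem IsLowerSet.subset_of_card_inter_le [DecidableEq α] {S T C : Finset α}
    (hS : IsLowerSet (S : Set α)) (hT : IsLowerSet (T : Set α))
    (hC : ∀ x ∈ C, ∀ y ∈ C, x ≤ y ∨ y ≤ x) (h : #(S ∩ C) ≤ #(T ∩ C)) : S ∩ C ⊆ T ∩ C := by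
  by_contra hST
  obtain ⟨x, hx, hxT⟩ := Finset.not_subset.1 hST
  rw [Finset.mem_inter] at hx hxT
  have hTS : T ∩ C ⊆ S ∩ C := fun y hy => by
    rw [Finset.mem_inter] at hy ⊢
    refine ⟨?_, hy.2⟩
    rcases hC x hx.2 y hy.2 with hxy | hyx
    · exact absurd ⟨hT hxy hy.1, hx.2⟩ hxT
    · exact hS hyx hx.1
  exact hST (Finset.eq_of_subset_of_card_le hTS h).symm.subset

open Classical in
/-- Counting the elements of a chain whose rank is below a threshold. -/
theorem card_filter_rank_lt {C : Finset α} (hC : ∀ x ∈ C, ∀ y ∈ C, x ≤ y ∨ y ≤ x) {k : ℕ}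
    (hk : k ≤ #C) : #{x ∈ C | #{y ∈ C | y < x} < k} = k := by
  have hlt {x y : α} (hx : x ∈ C) (hxy : x < y) : #{z ∈ C | z < x} < #{z ∈ C | z < y} := by
    refine Finset.card_lt_card (Finset.ssubset_iff_of_subset ?_ |>.2
      ⟨x, by simp [hx, hxy], by simp⟩)
    exact Finset.monotone_filter_right _ fun z _ hz => hz.trans hxy
  have hinj : Set.InjOn (fun x => #{y ∈ C | y < x}) (C : Set α) := by
    intro x hx y hy hxy
    by_contra hne
    rcases hC x hx y hy with h | h
    · exact (hlt hx (lt_of_le_of_ne h hne)).ne hxy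
    · exact (hlt hy (lt_of_le_of_ne h (Ne.symm hne))).ne' hxy
  have himage : C.image (fun x => #{y ∈ C | y < x}) = Finset.range #C := by
    refine Finset.eq_of_subset_of_card_le (fun n hn => ?_) ?_
    · obtain ⟨x, hx, rfl⟩ := Finset.mem_image.1 hn
      exact Finset.mem_range.2 (Finset.card_lt_card (Finset.filter_ssubset.2 ⟨x, hx, lt_irrefl x⟩))
    · rw [Finset.card_image_of_injOn hinj, Finset.card_range]
  have hrange : ({x ∈ C | #{y ∈ C | y < x} < k} : Finset α).image (fun x => #{y ∈ C | y < x}) =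
      Finset.range k := by
    rw [← Finset.filter_image (p := fun n => n < k), himage]
    ext n
    simp only [Finset.mem_filter, Finset.mem_range]
    omega
  rw [← Finset.card_image_of_injOn (hinj.mono (Finset.filter_subset _ C)), hrange,
    Finset.card_range]

/-- The downset lattice of a disjoint union of chains is a product of chains. -/
theorem nonempty_downFinset_orderIso [Fintype α] [DecidableEq α] {w : ℕ} {ℓ : Fin w → ℕ}
    {C : Fin w → Finset α}
    (hpart : ∀ x : α, ∃! i : Fin w, x ∈ C i)
    (hcard : ∀ i : Fin w, (C i).card = ℓ i)
    (hchain : ∀ i : Fin w, ∀ x ∈ C i, ∀ y ∈ C i, x ≤ y ∨ y ≤ x)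
    (hincomp : ∀ i j : Fin w, i ≠ j → ∀ x ∈ C i, ∀ y ∈ C j, ¬ x ≤ y) :
    Nonempty (DownFinset α ≃o ∀ i, Fin (ℓ i + 1)) := by
  classical
  let f : DownFinset α → ∀ i, Fin (ℓ i + 1) := fun S i =>
    ⟨#(S.1 ∩ C i), Nat.lt_succ_of_le (hcard i ▸ Finset.card_le_card Finset.inter_subset_right)⟩
  have hf (S T : DownFinset α) : f S ≤ f T ↔ S ≤ T := by
    constructor
    · intro h x hx
      obtain ⟨i, hi, -⟩ := hpart x
      exact (Finset.mem_inter.1 (S.2.subset_of_card_inter_le T.2 (hchain i) (h i)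
        (Finset.mem_inter.2 ⟨hx, hi⟩))).1
    · intro h i
      exact Finset.card_le_card (Finset.inter_subset_inter_right h)
  have hsurj : Function.Surjective f := by
    intro k
    have hlow : IsLowerSet ((({x | ∀ i, x ∈ C i → #{y ∈ C i | y < x} < k i} : Finset α)) :
        Set α) := by
      intro x y hyx hx
      simp only [Finset.coe_filter, Finset.mem_univ, true_and, Set.mem_ofPred_eq] at hx ⊢
      intro i hy
      obtain ⟨j, hj, -⟩ := hpart x
      obtain rfl : i = j := by
        by_contra hij
        exact hincomp i j hij y hy x hj hyx
      exact (Finset.card_le_card (Finset.monotone_filter_right _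
        fun z _ hz => hz.trans_le hyx)).trans_lt (hx i hj)
    refine ⟨⟨_, hlow⟩, funext fun i => Fin.ext ?_⟩
    have : ({x | ∀ i, x ∈ C i → #{y ∈ C i | y < x} < k i} : Finset α) ∩ C i =
        {x ∈ C i | #{y ∈ C i | y < x} < k i} := by
      ext x
      simp only [Finset.mem_inter, Finset.mem_filter, Finset.mem_univ, true_and]
      refine ⟨fun ⟨h, hi⟩ => ⟨hi, h i hi⟩, fun ⟨hi, h⟩ => ⟨fun j hj => ?_, hi⟩⟩
      obtain rfl := (hpart x).unique hi hj
      exact h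
    simp only [f]
    rw [this]
    exact card_filter_rank_lt (hchain i) ((Nat.lt_succ_iff.1 (k i).2).trans_eq (hcard i).symm)
  exact ⟨RelIso.ofSurjective (OrderEmbedding.ofMapLEIff f hf) hsurj⟩

end Chains

/-- If `P` is a disjoint union of chains `C₁, …, C_w` with `|C_i| = ℓ_i`, then
`4 · led(D_P) = (∏ (ℓ_i+1))² − ∑_k (ℓ_k+1)·ℓ_k·∏_{i≠k} (ℓ_i+1) − ∏ (ℓ_i+1)`. -/
theorem led_factor_lattice {α : Type*} [Fintype α] [PartialOrder α] [DecidableEq α]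
    (w : ℕ) (ℓ : Fin w → ℕ) (C : Fin w → Finset α)
    (hpart : ∀ x : α, ∃! i : Fin w, x ∈ C i)
    (hcard : ∀ i : Fin w, (C i).card = ℓ i)
    (hchain : ∀ i : Fin w, ∀ x ∈ C i, ∀ y ∈ C i, x ≤ y ∨ y ≤ x)
    (hincomp : ∀ i j : Fin w, i ≠ j → ∀ x ∈ C i, ∀ y ∈ C j, ¬ x ≤ y) :
    ∃ m : ℕ, IsGreatest {d : ℕ | ∃ L₁ L₂ : DownFinset α → DownFinset α → Prop,
        IsLinExt L₁ ∧ IsLinExt L₂ ∧ d = revCount L₁ L₂} m ∧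
      4 * m = (∏ i : Fin w, (ℓ i + 1)) ^ 2
        - (∑ k : Fin w, (ℓ k + 1) * ℓ k * ∏ i ∈ Finset.univ.erase k, (ℓ i + 1))
        - ∏ i : Fin w, (ℓ i + 1) := by
  obtain ⟨e⟩ := nonempty_downFinset_orderIso hpart hcard hchain hincomp
  obtain ⟨m, hm, h⟩ := exists_isGreatest_revCount e
  refine ⟨m, hm, ?_⟩
  have hsum : ∑ k : Fin w, (ℓ k + 1) * ℓ k * ∏ i ∈ Finset.univ.erase k, (ℓ i + 1) =
      (∏ i : Fin w, (ℓ i + 1)) * ∑ k : Fin w, ℓ k := by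
    rw [Finset.mul_sum]
    refine Finset.sum_congr rfl fun k _ => ?_
    rw [← Finset.mul_prod_erase Finset.univ (fun i => ℓ i + 1) (Finset.mem_univ k)]
    ring
  simp only [Fintype.card_fin, Nat.add_sub_cancel] at h
  rw [hsum]
  omega
end

section
/- Let P be a finite poset, σ a non-separating linear extension of P, and D ⊆ P a subset such that the induced subposet P[D] has at least two connected components. Let M be the set of maximal elements of P[D]. Then the σ-largest element of M and the σ-smallest element of M lie in different connected components of P[D]. -/
open Finset
open scoped symmDiff

/-- For a non-separating linear extension σ of a finite poset `P` and `D ⊆ P` such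
that `P[D]` has at least two connected components, the σ-largest and the σ-smallest maximal
elements of `P[D]` lie in different connected components of `P[D]`. -/
theorem extreme_maxima_in_different_components {α : Type*} [Fintype α] [PartialOrder α]
    [DecidableEq α]
    (σ : α → α → Prop) (hσ : IsLinExt σ) (hns : NonSeparating σ)
    (D : Finset α) (hD : 2 ≤ numComponents (↑D : Set α))
    (a b : α) (ha : a ∈ D) (hb : b ∈ D)
    (haMax : ∀ y ∈ D, a ≤ y → a = y) (hbMax : ∀ y ∈ D, b ≤ y → b = y)
    (haTop : ∀ x ∈ D, (∀ y ∈ D, x ≤ y → x = y) → σ x a)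
    (hbBot : ∀ x ∈ D, (∀ y ∈ D, x ≤ y → x = y) → σ b x) :
    ¬ (compGraph (↑D : Set α)).Reachable
        ⟨a, Finset.mem_coe.mpr ha⟩ ⟨b, Finset.mem_coe.mpr hb⟩ := by
  intro hab
  obtain ⟨hlin, hext⟩ := hσ
  set b' : (↑D : Set α) := ⟨b, Finset.mem_coe.mpr hb⟩
  have reach_of_le {u v : (↑D : Set α)} (h : (u : α) ≤ v ∨ (v : α) ≤ u) :
      (compGraph (↑D : Set α)).Reachable u v := by
    by_cases hne : u = v
    · exact hne ▸ SimpleGraph.Reachable.refl u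
    · exact ((SimpleGraph.fromRel_adj _ u v).mpr ⟨hne, h⟩).reachable
  -- A maximal element `m` of `D` outside the component of `b`.
  obtain ⟨m, hmMax, hmb⟩ : ∃ m : (↑D : Set α), (∀ y ∈ D, (m : α) ≤ y → (m : α) = y) ∧
      ¬ (compGraph (↑D : Set α)).Reachable b' m := by
    have : Nontrivial (compGraph (↑D : Set α)).ConnectedComponent :=
      Finite.one_lt_card_iff_nontrivial.mp hD
    obtain ⟨c, hc⟩ := exists_ne ((compGraph (↑D : Set α)).connectedComponentMk b')
    obtain ⟨x, rfl⟩ := c.exists_rep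
    obtain ⟨m, hxm, hm⟩ := D.exists_le_maximal (Finset.mem_coe.mp x.2)
    refine ⟨⟨m, Finset.mem_coe.mpr hm.prop⟩, fun y hy hmy => hm.eq_of_le hy hmy, fun h => ?_⟩
    exact hc (SimpleGraph.ConnectedComponent.sound
      ((reach_of_le (Or.inl hxm)).trans h.symm))
  have incomp {v : (↑D : Set α)} (hv : (compGraph (↑D : Set α)).Reachable b' v) :
      ¬ (m : α) ≤ v ∧ ¬ (v : α) ≤ m :=
    ⟨fun h => hmb (hv.trans (reach_of_le (Or.inr h))),
      fun h => hmb (hv.trans (reach_of_le (Or.inl h)))⟩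
  -- Non-separation keeps the whole component of `b` on the same side of `m`.
  have below {v : (↑D : Set α)} (hv : (compGraph (↑D : Set α)).Reachable b' v) :
      σ v m := by
    rw [SimpleGraph.reachable_iff_reflTransGen] at hv
    induction hv with
    | refl => exact hbBot m (Finset.mem_coe.mp m.2) hmMax
    | @tail u v hu huv ih =>
      have hu' := (SimpleGraph.reachable_iff_reflTransGen _ _).mpr hu
      obtain ⟨hmu, hum⟩ := incomp hu'
      obtain ⟨hmv, hvm⟩ := incomp (hu'.trans huv.reachable)
      by_contra hσv
      have hσmv : σ m v := (hlin.total (m : α) v).resolve_right hσv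
      obtain ⟨hne, hle | hle⟩ := (SimpleGraph.fromRel_adj _ u v).mp huv
      · exact hns ⟨u, v, m, lt_of_le_of_ne hle (Subtype.coe_injective.ne hne),
          hmu, hum, hmv, hvm, ih, fun h => hum h.le, hσmv, fun h => hmv h.le⟩
      · exact hσv (hlin.trans _ _ _ (hext _ _ hle) ih)
  have hma : (m : α) = a := hlin.antisymm _ _
    (haTop m (Finset.mem_coe.mp m.2) hmMax) (below hab.symm)
  exact (incomp hab.symm).1 hma.le
end

section
/- Let P be a finite poset, σ a non-separating linear extension of P, A a nonempty antichain of P, and x the σ-largest element of A. If y is an element of P with x <_σ y and y incomparable to x in P, then A ∪ {y} is an antichain of P. -/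
open Finset
open scoped symmDiff

/-- For a non-separating linear extension σ of a finite poset `P`, a nonempty
antichain `A` with σ-largest element `x`, and `y` with `x <_σ y` incomparable to `x`, the set
`A ∪ {y}` is again an antichain. -/
theorem insert_above_max_antichain {α : Type*} [Fintype α] [PartialOrder α] [DecidableEq α]
    (σ : α → α → Prop) (hσ : IsLinExt σ) (hns : NonSeparating σ)
    (A : Finset α) (hA : IsAntichain (· ≤ ·) (↑A : Set α)) (hne : A.Nonempty)
    (x : α) (hx : x ∈ A) (hxmax : ∀ a ∈ A, σ a x)
    (y : α) (hxy : σ x y) (hxyne : x ≠ y) (h1 : ¬ x ≤ y) (h2 : ¬ y ≤ x) :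
    IsAntichain (· ≤ ·) (↑(insert y A) : Set α) := by
  obtain ⟨hlin, hext⟩ := hσ
  have not_le_of_mem : ∀ a ∈ A, ¬ y ≤ a := fun a ha hya =>
    hxyne (hlin.antisymm _ _ hxy (hlin.trans _ _ _ (hext _ _ hya) (hxmax a ha)))
  have not_ge_of_mem : ∀ a ∈ A, y ≠ a → ¬ a ≤ y := by
    intro a ha hya hay
    have hxa : x ≠ a := by
      rintro rfl
      exact h1 hay
    exact hns ⟨a, y, x, lt_of_le_of_ne hay hya.symm, hA hx ha hxa, hA ha hx hxa.symm, h1, h2,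
      hxmax a ha, hxa.symm, hxy, hxyne⟩
  rw [Finset.coe_insert, isAntichain_insert]
  exact ⟨hA, fun a ha hya => ⟨not_le_of_mem a ha, not_ge_of_mem a ha hya⟩⟩
end
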